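/- Let Ω ⊂ ℝⁿ be a bounded strictly convex open domain with smooth boundary and diameter D = diam(Ω), and let V : Ω̄ → ℝ be a smooth convex potential. Let φ₀ be the ground state of the Schrödinger operator L = −Δ + V with Dirichlet boundary condition on Ω, with ground state energy λ₀, and let (λ₁, φ₁) be any other Dirichlet eigenpair of L, i.e. φ₁ is smooth on Ω̄, vanishes on ∂Ω, satisfies −Δφ₁ + Vφ₁ = λ₁φ₁ on Ω, and φ₁/φ₀ is not constant on Ω. Then λ₁ − λ₀ ≥ 3π²/D². -/

import Mathlib

open Metric Set
open scoped RealInnerProductSpace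

/-- The Laplacian of a function on Euclidean space, `Δ f x = ∑ i ∂²f/∂xᵢ²`. -/
noncomputable def lap {n : ℕ} (f : EuclideanSpace ℝ (Fin n) → ℝ)
    (x : EuclideanSpace ℝ (Fin n)) : ℝ :=
  ∑ i : Fin n, fderiv ℝ (fun y => fderiv ℝ f y (EuclideanSpace.single i 1)) x
    (EuclideanSpace.single i 1)

open Filter Topology

section Calculus

variable {E : Type*} [NormedAddCommGroup E] [NormedSpace ℝ E]

/-- The second derivative of a function of one variable is nonpositive at a local maximum. -/
theorem IsLocalMax.second_deriv_nonpos {g g' : ℝ → ℝ} {a x : ℝ} (hmax : IsLocalMax g x)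
    (hg : ∀ᶠ t in 𝓝 x, HasDerivAt g (g' t) t) (hg' : HasDerivAt g' a x) : a ≤ 0 := by
  by_contra! ha
  have hd : deriv g =ᶠ[𝓝 x] g' := hg.mono fun t ht => ht.deriv
  have h2 : deriv (deriv g) x = a := by rw [hd.deriv_eq, hg'.deriv]
  have hmin : IsLocalMin g x :=
    isLocalMin_of_deriv_deriv_pos (by rwa [h2]) hmax.deriv_eq_zero hg.self_of_nhds.continuousAt
  have hc : g =ᶠ[𝓝 x] fun _ => g x := by
    filter_upwards [hmin, hmax] with t h1 h2 using le_antisymm h2 h1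
  have h0 : deriv g =ᶠ[𝓝 x] fun _ => 0 := by
    filter_upwards [hc.eventuallyEq_nhds] with t ht
    rw [ht.deriv_eq]; simp
  rw [h0.deriv_eq] at h2
  simp at h2
  linarith

theorem hasDerivAt_comp_line {f : E → ℝ} {x η : E} {t : ℝ}
    (hf : DifferentiableAt ℝ f (x + t • η)) :
    HasDerivAt (fun s : ℝ => f (x + s • η)) (fderiv ℝ f (x + t • η) η) t := by
  have h1 : HasDerivAt (fun s : ℝ => x + s • η) η t := by
    simpa using ((hasDerivAt_id t).smul_const η).const_add x
  exact hf.hasFDerivAt.comp_hasDerivAt t h1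

theorem hasDerivAt_comp_line_zero {f : E → ℝ} {x η : E} (hf : DifferentiableAt ℝ f x) :
    HasDerivAt (fun s : ℝ => f (x + s • η)) (fderiv ℝ f x η) 0 := by
  have := hasDerivAt_comp_line (f := f) (x := x) (η := η) (t := 0) (by simpa using hf)
  simpa using this

theorem tendsto_line_zero (x η : E) : Tendsto (fun t : ℝ => x + t • η) (𝓝 0) (𝓝 x) := by
  have : Continuous fun t : ℝ => x + t • η := by fun_prop
  simpa using this.tendsto 0

theorem ContDiffAt.eventually_hasDerivAt_comp_line {f : E → ℝ} {x : E}
    (hf : ContDiffAt ℝ 2 f x) (η : E) :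
    ∀ᶠ t : ℝ in 𝓝 0,
      HasDerivAt (fun s : ℝ => f (x + s • η)) (fderiv ℝ f (x + t • η) η) t := by
  have h : ∀ᶠ y in 𝓝 x, ContDiffAt ℝ 2 f y := hf.eventually (by simp)
  filter_upwards [(tendsto_line_zero x η).eventually h] with t ht
  exact hasDerivAt_comp_line (ht.differentiableAt (by simp))

theorem ContDiffAt.fderiv_apply {f : E → ℝ} {x : E} {k m : WithTop ℕ∞}
    (hf : ContDiffAt ℝ k f x) (hk : m + 1 ≤ k) (η : E) :
    ContDiffAt ℝ m (fun y => fderiv ℝ f y η) x :=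
  (hf.fderiv_right hk).clm_apply contDiffAt_const

theorem ContDiffAt.fderiv_fderiv_apply {f : E → ℝ} {x : E} (hf : ContDiffAt ℝ 2 f x) (η ξ : E) :
    fderiv ℝ (fun y => fderiv ℝ f y η) x ξ = fderiv ℝ (fderiv ℝ f) x ξ η := by
  have : DifferentiableAt ℝ (fderiv ℝ f) x :=
    (hf.fderiv_right (m := 1) (by norm_num)).differentiableAt (by simp)
  rw [fderiv_clm_apply this (by fun_prop)]
  simp

theorem ContDiffAt.fderiv_fderiv_comm {f : E → ℝ} {x : E} (hf : ContDiffAt ℝ 2 f x) (η ξ : E) :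
    fderiv ℝ (fun y => fderiv ℝ f y η) x ξ = fderiv ℝ (fun y => fderiv ℝ f y ξ) x η := by
  rw [hf.fderiv_fderiv_apply, hf.fderiv_fderiv_apply]
  exact (hf.isSymmSndFDerivAt (by simp)) ξ η

/-- The derivative along a line of the directional derivative in that direction. -/
theorem ContDiffAt.hasDerivAt_fderiv_comp_line {f : E → ℝ} {x : E} (hf : ContDiffAt ℝ 2 f x)
    (η ξ : E) :
    HasDerivAt (fun s : ℝ => fderiv ℝ f (x + s • η) ξ)
      (fderiv ℝ (fun y => fderiv ℝ f y ξ) x η) 0 :=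
  hasDerivAt_comp_line_zero (f := fun y => fderiv ℝ f y ξ)
    ((hf.fderiv_apply (m := 1) (by norm_num) ξ).differentiableAt (by simp))

end Calculus

section Laplacian

variable {n : ℕ}

/-- Points of Euclidean `n`-space. -/
abbrev Euc (n : ℕ) := EuclideanSpace ℝ (Fin n)

theorem lap_eq_sum_orthonormalBasis {f : Euc n → ℝ} {x : Euc n} (hf : ContDiffAt ℝ 2 f x)
    (b : OrthonormalBasis (Fin n) ℝ (Euc n)) :
    lap f x = ∑ i, fderiv ℝ (fun y => fderiv ℝ f y (b i)) x (b i) := by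
  have key : ∀ b : OrthonormalBasis (Fin n) ℝ (Euc n),
      ∑ i, fderiv ℝ (fun y => fderiv ℝ f y (b i)) x (b i) = Laplacian.laplacian f x := by
    intro b
    rw [InnerProductSpace.laplacian_eq_iteratedFDeriv_orthonormalBasis f b]
    refine Finset.sum_congr rfl fun i _ => ?_
    rw [hf.fderiv_fderiv_apply, iteratedFDeriv_two_apply]
    simp
  rw [key b, ← key (EuclideanSpace.basisFun (Fin n) ℝ)]
  simp [lap]

theorem sum_inner_single_sq (e : Euc n) :
    ∑ i, ⟪e, EuclideanSpace.single i (1 : ℝ)⟫ ^ 2 = ‖e‖ ^ 2 := by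
  simp [EuclideanSpace.norm_sq_eq, EuclideanSpace.inner_single_right]

theorem sum_fderiv_single_sq (f : Euc n → ℝ) (x : Euc n) :
    ∑ i, (fderiv ℝ f x (EuclideanSpace.single i (1 : ℝ))) ^ 2 = ‖gradient f x‖ ^ 2 := by
  rw [← sum_inner_single_sq]
  simp only [inner_gradient_left]

theorem sum_fderiv_single_mul (f g : Euc n → ℝ) (x : Euc n) :
    ∑ i, fderiv ℝ f x (EuclideanSpace.single i (1 : ℝ)) *
      fderiv ℝ g x (EuclideanSpace.single i (1 : ℝ)) = ⟪gradient f x, gradient g x⟫ := by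
  rw [← (EuclideanSpace.basisFun (Fin n) ℝ).sum_inner_mul_inner (gradient f x) (gradient g x)]
  refine Finset.sum_congr rfl fun i _ => ?_
  rw [real_inner_comm (gradient g x)]
  simp only [inner_gradient_left, EuclideanSpace.basisFun_apply]

theorem lap_add_smul {f g : Euc n → ℝ} {x : Euc n} (hf : ContDiffAt ℝ 2 f x)
    (hg : ContDiffAt ℝ 2 g x) (c : ℝ) :
    lap (fun y => f y + c * g y) x = lap f x + c * lap g x := by
  have hfe : ∀ᶠ y in 𝓝 x, ContDiffAt ℝ 2 f y := hf.eventually (by simp)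
  have hge : ∀ᶠ y in 𝓝 x, ContDiffAt ℝ 2 g y := hg.eventually (by simp)
  simp only [lap, Finset.mul_sum, ← Finset.sum_add_distrib]
  refine Finset.sum_congr rfl fun i _ => ?_
  set e : Euc n := EuclideanSpace.single i 1
  have h1 : (fun y => fderiv ℝ (fun y => f y + c * g y) y e) =ᶠ[𝓝 x]
      fun y => fderiv ℝ f y e + c * fderiv ℝ g y e := by
    filter_upwards [hfe, hge] with y h1 h2
    have d1 := h1.differentiableAt (by simp)
    have d2 := h2.differentiableAt (by simp)
    rw [(d1.hasFDerivAt.fun_add (d2.hasFDerivAt.const_mul c)).fderiv]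
    simp
  have d1 := (hf.fderiv_apply (m := 1) (by norm_num) e).differentiableAt (by simp)
  have d2 := (hg.fderiv_apply (m := 1) (by norm_num) e).differentiableAt (by simp)
  rw [h1.fderiv_eq, (d1.hasFDerivAt.fun_add (d2.hasFDerivAt.const_mul c)).fderiv]
  simp

theorem lap_fderiv_apply {f : Euc n → ℝ} {x : Euc n} (hf : ContDiffAt ℝ 3 f x) (e : Euc n) :
    lap (fun y => fderiv ℝ f y e) x = fderiv ℝ (lap f) x e := by
  have hfe : ∀ᶠ y in 𝓝 x, ContDiffAt ℝ 3 f y := hf.eventually (by simp)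
  have hd : ∀ η : Euc n, ContDiffAt ℝ 2 (fun y => fderiv ℝ f y η) x := fun η =>
    hf.fderiv_apply (by norm_num) η
  have hdd : ∀ η : Euc n,
      DifferentiableAt ℝ (fun y => fderiv ℝ (fun y => fderiv ℝ f y η) y η) x := fun η =>
    ((hd η).fderiv_apply (m := 1) (by norm_num) η).differentiableAt (by simp)
  have : fderiv ℝ (lap f) x = ∑ i : Fin n, fderiv ℝ (fun y => fderiv ℝ (fun y => fderiv ℝ f y
      (EuclideanSpace.single i 1)) y (EuclideanSpace.single i 1)) x := by
    have h := HasFDerivAt.fun_sum (u := Finset.univ) fun i _ =>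
      (hdd (EuclideanSpace.single i 1)).hasFDerivAt
    exact h.fderiv
  rw [this, _root_.sum_apply, lap]
  refine Finset.sum_congr rfl fun i _ => ?_
  set η : Euc n := EuclideanSpace.single i 1
  have h1 : (fun y => fderiv ℝ (fun y => fderiv ℝ f y e) y η) =ᶠ[𝓝 x]
      fun y => fderiv ℝ (fun y => fderiv ℝ f y η) y e := by
    filter_upwards [hfe] with y hy
    exact (hy.of_le (by norm_num)).fderiv_fderiv_comm e η
  rw [h1.fderiv_eq, (hd η).fderiv_fderiv_comm]

theorem lap_log {f : Euc n → ℝ} {x : Euc n} (hf : ContDiffAt ℝ 2 f x) (hx : f x ≠ 0) :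
    lap (fun y => Real.log (f y)) x + ‖gradient (fun y => Real.log (f y)) x‖ ^ 2
      = lap f x / f x := by
  have hfe : ∀ᶠ y in 𝓝 x, ContDiffAt ℝ 2 f y := hf.eventually (by simp)
  have hne : ∀ᶠ y in 𝓝 x, f y ≠ 0 := hf.continuousAt.eventually_ne hx
  rw [← sum_fderiv_single_sq, lap, ← Finset.sum_add_distrib, lap, Finset.sum_div]
  refine Finset.sum_congr rfl fun i _ => ?_
  set e : Euc n := EuclideanSpace.single i 1
  have h1 : (fun y => fderiv ℝ (fun y => Real.log (f y)) y e) =ᶠ[𝓝 x]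
      fun y => fderiv ℝ f y e / f y := by
    filter_upwards [hfe, hne] with y h1 h2
    rw [((h1.differentiableAt (by simp)).hasFDerivAt.log h2).fderiv]
    simp; ring
  have d1 := (hf.fderiv_apply (m := 1) (by norm_num) e).differentiableAt (by simp)
  have d2 := hf.differentiableAt (by simp)
  have h3 : fderiv ℝ (fun y => fderiv ℝ f y e / f y) x e =
      (fderiv ℝ (fun y => fderiv ℝ f y e) x e * f x - fderiv ℝ f x e * fderiv ℝ f x e)
        / f x ^ 2 := by
    have := ((hasDerivAt_comp_line_zero (η := e) d1).div (hasDerivAt_comp_line_zero (η := e) d2)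
      (by simpa using hx))
    have h4 := hasDerivAt_comp_line_zero (η := e) (f := fun y => fderiv ℝ f y e / f y)
      (by simpa only [div_eq_mul_inv] using d1.fun_mul (d2.fun_inv hx))
    rw [h4.unique this]
    simp
  have h5 := h1.self_of_nhds
  simp only at h5
  rw [h1.fderiv_eq, h3, h5]
  field_simp
  ring

theorem lap_mul {f g : Euc n → ℝ} {x : Euc n} (hf : ContDiffAt ℝ 2 f x)
    (hg : ContDiffAt ℝ 2 g x) :
    lap (fun y => f y * g y) x =
      f x * lap g x + g x * lap f x + 2 * ⟪gradient f x, gradient g x⟫ := by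
  have hfe : ∀ᶠ y in 𝓝 x, ContDiffAt ℝ 2 f y := hf.eventually (by simp)
  have hge : ∀ᶠ y in 𝓝 x, ContDiffAt ℝ 2 g y := hg.eventually (by simp)
  simp only [← sum_fderiv_single_mul, lap, Finset.mul_sum, ← Finset.sum_add_distrib]
  refine Finset.sum_congr rfl fun i _ => ?_
  set e : Euc n := EuclideanSpace.single i 1
  have h1 : (fun y => fderiv ℝ (fun y => f y * g y) y e) =ᶠ[𝓝 x]
      fun y => f y * fderiv ℝ g y e + g y * fderiv ℝ f y e := by
    filter_upwards [hfe, hge] with y h1 h2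
    have d1 := h1.differentiableAt (by simp)
    have d2 := h2.differentiableAt (by simp)
    rw [(d1.hasFDerivAt.fun_mul d2.hasFDerivAt).fderiv]
    simp
  have d1 := (hf.fderiv_apply (m := 1) (by norm_num) e).differentiableAt (by simp)
  have d2 := (hg.fderiv_apply (m := 1) (by norm_num) e).differentiableAt (by simp)
  have d3 := hf.differentiableAt (by simp)
  have d4 := hg.differentiableAt (by simp)
  rw [h1.fderiv_eq, ((d3.hasFDerivAt.fun_mul d2.hasFDerivAt).fun_add
    (d4.hasFDerivAt.fun_mul d1.hasFDerivAt)).fderiv]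
  simp
  ring

end Laplacian

section MaximumPrinciple

variable {n : ℕ}

/-- Second order condition at a maximum of `f₁ y - f₂ x - Φ ‖y - x‖`, tested along the motions
which move `y` by `η` and `x` by the reflection of `η` in the hyperplane orthogonal to `e`. -/
theorem lap_sub_lap_le {f₁ f₂ : Euc n → ℝ} {x y e : Euc n} (h₁ : ContDiffAt ℝ 2 f₁ y)
    (h₂ : ContDiffAt ℝ 2 f₂ x) (he : ‖e‖ = 1) {Φ Φ' : ℝ → ℝ} {r Φ'' : ℝ}
    (hΦ : ∀ᶠ s in 𝓝 r, HasDerivAt Φ (Φ' s) s) (hΦ' : HasDerivAt Φ' Φ'' r)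
    (hmax : ∀ η : Euc n, IsLocalMax (fun t : ℝ => f₁ (y + t • η)
      - f₂ (x + t • (η - (2 * ⟪e, η⟫) • e)) - Φ (r + t * (2 * ⟪e, η⟫))) 0) :
    lap f₁ y - lap f₂ x ≤ 4 * Φ'' := by
  set R : Euc n ≃ₗᵢ[ℝ] Euc n := (ℝ ∙ e)ᗮ.reflection with hR
  have hRη : ∀ η, R η = η - (2 * ⟪e, η⟫) • e := by
    intro η
    rw [hR, Submodule.reflection_orthogonal_apply, Submodule.reflection_singleton_apply, he]
    simp [two_smul, add_smul, two_mul]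
  set b := (EuclideanSpace.basisFun (Fin n) ℝ).map R with hb
  rw [lap_eq_sum_orthonormalBasis h₂ b, lap, ← Finset.sum_sub_distrib]
  have key : ∀ i : Fin n, fderiv ℝ (fun y => fderiv ℝ f₁ y (EuclideanSpace.single i 1)) y
      (EuclideanSpace.single i 1) - fderiv ℝ (fun y => fderiv ℝ f₂ y (b i)) x (b i)
      ≤ 4 * Φ'' * ⟪e, EuclideanSpace.single i (1 : ℝ)⟫ ^ 2 := by
    intro i
    set η : Euc n := EuclideanSpace.single i 1
    have hbi : b i = η - (2 * ⟪e, η⟫) • e := by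
      rw [← hRη]; simp [hb, η]
    rw [hbi]
    set ξ := η - (2 * ⟪e, η⟫) • e
    set κ := 2 * ⟪e, η⟫ with hκ
    have hlin : ∀ t : ℝ, HasDerivAt (fun t : ℝ => r + t * κ) κ t := fun t => by
      simpa using ((hasDerivAt_id t).mul_const κ).const_add r
    have hlin0 : Tendsto (fun t : ℝ => r + t * κ) (𝓝 0) (𝓝 r) := by
      simpa using (hlin 0).continuousAt.tendsto
    have h := (hmax η).second_deriv_nonpos
      (g' := fun t => fderiv ℝ f₁ (y + t • η) η - fderiv ℝ f₂ (x + t • ξ) ξ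
        - Φ' (r + t * κ) * κ)
      (a := fderiv ℝ (fun y => fderiv ℝ f₁ y η) y η - fderiv ℝ (fun y => fderiv ℝ f₂ y ξ) x ξ
        - Φ'' * κ * κ) ?_ ?_
    · rw [show 4 * Φ'' * ⟪e, η⟫ ^ 2 = Φ'' * κ * κ by rw [hκ]; ring]
      linarith
    · filter_upwards [h₁.eventually_hasDerivAt_comp_line η,
        h₂.eventually_hasDerivAt_comp_line ξ, hlin0.eventually hΦ] with t t1 t2 t3
      exact (t1.sub t2).sub (t3.comp t (hlin t))
    · refine ((h₁.hasDerivAt_fderiv_comp_line η η).sub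
        (h₂.hasDerivAt_fderiv_comp_line ξ ξ)).sub (HasDerivAt.mul_const ?_ κ)
      have h0 : HasDerivAt Φ' Φ'' (r + 0 * κ) := by simpa using hΦ'
      exact h0.comp 0 (hlin 0)
  calc _ ≤ ∑ i : Fin n, 4 * Φ'' * ⟪e, EuclideanSpace.single i (1 : ℝ)⟫ ^ 2 :=
        Finset.sum_le_sum fun i _ => key i
    _ = 4 * Φ'' := by rw [← Finset.mul_sum, sum_inner_single_sq, he]; ring

/-- Along the motions of `lap_sub_lap_le` the direction of `y - x` does not change. -/
theorem eventually_reflected_motion {Ω : Set (Euc n)} (hΩ : IsOpen Ω) {x y e : Euc n}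
    (hx : x ∈ Ω) (hy : y ∈ Ω) (he : ‖e‖ = 1) {r : ℝ} (hr : 0 < r) (hre : y - x = r • e)
    (η : Euc n) :
    ∀ᶠ t : ℝ in 𝓝 0, x + t • (η - (2 * ⟪e, η⟫) • e) ∈ Ω ∧ y + t • η ∈ Ω ∧
      0 < r + t * (2 * ⟪e, η⟫) ∧
      (y + t • η) - (x + t • (η - (2 * ⟪e, η⟫) • e)) = (r + t * (2 * ⟪e, η⟫)) • e ∧
      ‖(y + t • η) - (x + t • (η - (2 * ⟪e, η⟫) • e))‖ = r + t * (2 * ⟪e, η⟫) := by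
  have hlin0 : Tendsto (fun t : ℝ => r + t * (2 * ⟪e, η⟫)) (𝓝 0) (𝓝 r) := by
    have : Continuous fun t : ℝ => r + t * (2 * ⟪e, η⟫) := by fun_prop
    simpa using this.tendsto 0
  filter_upwards [(tendsto_line_zero x _).eventually (hΩ.mem_nhds hx),
    (tendsto_line_zero y η).eventually (hΩ.mem_nhds hy),
    hlin0.eventually (lt_mem_nhds hr)] with t h1 h2 h3
  have h4 : (y + t • η) - (x + t • (η - (2 * ⟪e, η⟫) • e)) = (r + t * (2 * ⟪e, η⟫)) • e := by
    rw [add_smul, ← hre]; module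
  refine ⟨h1, h2, h3, h4, ?_⟩
  rw [h4, norm_smul, he, Real.norm_of_nonneg h3.le, mul_one]

/-- A continuous function on a bounded set which is small near the missing limit points attains
its maximum. -/
theorem exists_isMaxOn_of_boundary {X : Type*} [PseudoMetricSpace X] [ProperSpace X] {W : Set X}
    (hW : Bornology.IsBounded W) {F : X → ℝ} (hF : ContinuousOn F W) {p₀ : X} (hp₀ : p₀ ∈ W)
    (hbd : ∀ q ∈ closure W, q ∉ W → ∀ᶠ p in 𝓝[W] q, F p < F p₀) :
    ∃ p ∈ W, ∀ p' ∈ W, F p' ≤ F p := by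
  set A := {p ∈ W | F p₀ ≤ F p} with hA
  have hAc : IsClosed A := by
    refine isClosed_of_closure_subset fun q hq => ?_
    have hqW : q ∈ closure W := closure_mono (sep_subset _ _) hq
    have hfreq : ∃ᶠ p in 𝓝[W] q, F p₀ ≤ F p := by
      rw [mem_closure_iff_frequently] at hq
      rw [frequently_nhdsWithin_iff]
      exact hq.mono fun p hp => ⟨hp.2, hp.1⟩
    have hqW' : q ∈ W := by
      by_contra hn
      exact hfreq ((hbd q hqW hn).mono fun p hp => not_le.mpr hp)
    refine ⟨hqW', ?_⟩
    by_contra! hlt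
    exact hfreq (((hF q hqW').eventually (gt_mem_nhds hlt)).mono fun p hp => not_le.mpr hp)
  have hAcomp : IsCompact A :=
    isCompact_of_isClosed_isBounded hAc (hW.subset (sep_subset _ _))
  obtain ⟨p, hp, hmax⟩ := hAcomp.exists_isMaxOn ⟨p₀, hp₀, le_rfl⟩
    (hF.mono (sep_subset _ _))
  refine ⟨p, hp.1, fun p' hp' => ?_⟩
  by_cases h : F p₀ ≤ F p'
  · exact hmax ⟨hp', h⟩
  · exact (not_le.mp h).le.trans hp.2

end MaximumPrinciple

section LogConcavity

variable {n : ℕ}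

theorem exists_pos_mul_lt_and {b₁ b₂ : ℝ} (h₁ : 0 < b₁) (h₂ : 0 < b₂) (a₁ a₂ : ℝ) :
    ∃ ε > 0, ε * a₁ < b₁ ∧ ε * a₂ < b₂ := by
  have t : ∀ a : ℝ, Tendsto (fun ε : ℝ => ε * a) (𝓝[>] 0) (𝓝 0) := fun a => by
    have : Continuous fun ε : ℝ => ε * a := by fun_prop
    simpa using (this.tendsto 0).mono_left nhdsWithin_le_nhds
  obtain ⟨ε, h, h1, h2⟩ := (eventually_mem_nhdsWithin.and
    (((t a₁).eventually (gt_mem_nhds h₁)).and ((t a₂).eventually (gt_mem_nhds h₂)))).exists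
  exact ⟨ε, h, h1, h2⟩

/-- `v` is the logarithm of a positive function `φ` on the bounded convex open set `Ω`, vanishing
on the boundary and satisfying `Δ φ = U φ` with a convex potential `U ≥ -M`. -/
structure IsLogGroundState (Ω : Set (Euc n)) (v U : Euc n → ℝ) (M S : ℝ) : Prop where
  isOpen : IsOpen Ω
  isBounded : Bornology.IsBounded Ω
  contDiffAt : ∀ x ∈ Ω, ContDiffAt ℝ 3 v x
  lap_add : ∀ x ∈ Ω, lap v x + ‖gradient v x‖ ^ 2 = U x
  convexOn : ConvexOn ℝ Ω U
  differentiableAt : ∀ x ∈ Ω, DifferentiableAt ℝ U x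
  neg_le : ∀ x ∈ Ω, -M ≤ U x
  le_upper : ∀ x ∈ Ω, v x ≤ S
  tendsto_atBot : ∀ q ∈ frontier Ω, Tendsto v (𝓝[Ω] q) atBot

namespace IsLogGroundState

variable {Ω : Set (Euc n)} {v U : Euc n → ℝ} {M S : ℝ}

theorem continuousOn (h : IsLogGroundState Ω v U M S) : ContinuousOn v Ω :=
  fun x hx => (h.contDiffAt x hx).continuousAt.continuousWithinAt

theorem contDiffAt_two (h : IsLogGroundState Ω v U M S) {x : Euc n} (hx : x ∈ Ω) :
    ContDiffAt ℝ 2 v x := (h.contDiffAt x hx).of_le (by norm_num)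

theorem differentiableAt' (h : IsLogGroundState Ω v U M S) {x : Euc n} (hx : x ∈ Ω) :
    DifferentiableAt ℝ v x := (h.contDiffAt x hx).differentiableAt (by simp)

theorem half_mem (h : IsLogGroundState Ω v U M S) {x y : Euc n} (hx : x ∈ Ω) (hy : y ∈ Ω) :
    (1 / 2 : ℝ) • (x + y) ∈ Ω := by
  rw [smul_add]
  exact h.convexOn.1 hx hy (by norm_num) (by norm_num) (by norm_num)

theorem tendsto_prod (h : IsLogGroundState Ω v U M S) {q : Euc n × Euc n}
    (hq : q ∈ closure (Ω ×ˢ Ω)) (hq' : q ∉ Ω ×ˢ Ω) :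
    Tendsto (fun p : Euc n × Euc n => v p.1 + v p.2) (𝓝[Ω ×ˢ Ω] q) atBot := by
  rw [closure_prod_eq] at hq
  have hfr : ∀ x ∈ closure Ω, x ∉ Ω → x ∈ frontier Ω := fun x h1 h2 => by
    rw [h.isOpen.frontier_eq]; exact ⟨h1, h2⟩
  rw [show 𝓝[Ω ×ˢ Ω] q = 𝓝[Ω] q.1 ×ˢ 𝓝[Ω] q.2 from nhdsWithin_prod_eq q.1 q.2 Ω Ω]
  have e1 : ∀ᶠ p : Euc n × Euc n in 𝓝[Ω] q.1 ×ˢ 𝓝[Ω] q.2, v p.1 ≤ S :=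
    tendsto_fst.eventually (eventually_mem_nhdsWithin.mono fun x hx => h.le_upper x hx)
  have e2 : ∀ᶠ p : Euc n × Euc n in 𝓝[Ω] q.1 ×ˢ 𝓝[Ω] q.2, v p.2 ≤ S :=
    tendsto_snd.eventually (eventually_mem_nhdsWithin.mono fun x hx => h.le_upper x hx)
  by_cases h1 : q.1 ∈ Ω
  · have h2 : q.2 ∉ Ω := fun h2 => hq' ⟨h1, h2⟩
    exact tendsto_atBot_add_left_of_ge' _ S e1
      ((h.tendsto_atBot _ (hfr _ hq.2 h2)).comp tendsto_snd)
  · exact tendsto_atBot_add_right_of_ge' _ S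
      ((h.tendsto_atBot _ (hfr _ hq.1 h1)).comp tendsto_fst) e2

set_option maxHeartbeats 2000000 in
/-- Korevaar's concavity principle: `v` is midpoint concave. -/
theorem midpoint_concave (h : IsLogGroundState Ω v U M S) {C B : ℝ}
    (hC : ∀ x ∈ Ω, ∀ y ∈ Ω, v x + v y - 2 * v ((1 / 2 : ℝ) • (x + y)) ≤ C)
    (hB : ∀ x ∈ Ω, ∀ y ∈ Ω, |⟪gradient v ((1 / 2 : ℝ) • (x + y)), y - x⟫| ≤ B)
    (hdiag : ∀ m > 0, ∃ ρ > 0, ∀ x ∈ Ω, ∀ y ∈ Ω, ‖y - x‖ < ρ →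
      v x + v y - 2 * v ((1 / 2 : ℝ) • (x + y)) < m)
    {x₀ y₀ : Euc n} (hx₀ : x₀ ∈ Ω) (hy₀ : y₀ ∈ Ω) :
    v x₀ + v y₀ ≤ 2 * v ((1 / 2 : ℝ) • (x₀ + y₀)) := by
  by_contra! hlt
  set m := v x₀ + v y₀ - 2 * v ((1 / 2 : ℝ) • (x₀ + y₀)) with hm
  have hm0 : 0 < m := by linarith
  obtain ⟨ρ, hρ, hρm⟩ := hdiag (m / 2) (by positivity)
  have hB0 : 0 ≤ B := (abs_nonneg _).trans (hB x₀ hx₀ y₀ hy₀)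
  obtain ⟨R, hR0, hR⟩ : ∃ R > 0, ∀ x ∈ Ω, ‖x‖ ≤ R := h.isBounded.exists_pos_norm_le
  set K := (2 * B + 2) / ρ ^ 2 with hK
  have hK0 : 0 < K := by positivity
  set f : Euc n × Euc n → ℝ := fun p => Real.exp (K * ((‖p.2‖ ^ 2 - ‖p.1‖ ^ 2) / 2)) with hf
  set f₁ := Real.exp (K * R ^ 2)
  set f₀ := Real.exp (-(K * R ^ 2))
  have hf₁0 : 0 < f₁ := Real.exp_pos _
  have hf₀0 : 0 < f₀ := Real.exp_pos _
  have hff : ∀ p ∈ Ω ×ˢ Ω, f₀ ≤ f p ∧ f p ≤ f₁ := by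
    intro p hp
    have h1 : ‖p.1‖ ^ 2 ≤ R ^ 2 := pow_le_pow_left₀ (norm_nonneg _) (hR _ hp.1) 2
    have h2 : ‖p.2‖ ^ 2 ≤ R ^ 2 := pow_le_pow_left₀ (norm_nonneg _) (hR _ hp.2) 2
    constructor
    · apply Real.exp_le_exp.mpr
      rw [← mul_neg]
      apply mul_le_mul_of_nonneg_left _ hK0.le
      nlinarith [sq_nonneg ‖p.1‖, sq_nonneg ‖p.2‖]
    · apply Real.exp_le_exp.mpr
      apply mul_le_mul_of_nonneg_left _ hK0.le
      nlinarith [sq_nonneg ‖p.1‖, sq_nonneg ‖p.2‖]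
  obtain ⟨θ, hθ0, hθ1, hθ2⟩ := exists_pos_mul_lt_and one_pos (show 0 < m / 8 by positivity)
    (K * f₁ * (2 * R ^ 2)) f₁
  obtain ⟨ε, hε0, hε1, hε2⟩ := exists_pos_mul_lt_and (show 0 < θ * K * f₀ by positivity)
    (show 0 < m / 8 by positivity) (2 * M) (|v x₀ + v y₀| + 2 * |S|)
  set F : Euc n × Euc n → ℝ := fun p => (1 + ε) * (v p.1 + v p.2)
    - 2 * v ((1 / 2 : ℝ) • (p.1 + p.2)) + θ * f p with hF
  have hFcont : ContinuousOn F (Ω ×ˢ Ω) := by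
    have c1 : ContinuousOn (fun p : Euc n × Euc n => v p.1) (Ω ×ˢ Ω) :=
      h.continuousOn.comp continuousOn_fst fun p hp => hp.1
    have c2 : ContinuousOn (fun p : Euc n × Euc n => v p.2) (Ω ×ˢ Ω) :=
      h.continuousOn.comp continuousOn_snd fun p hp => hp.2
    have c3 : ContinuousOn (fun p : Euc n × Euc n => v ((1 / 2 : ℝ) • (p.1 + p.2))) (Ω ×ˢ Ω) :=
      h.continuousOn.comp (by fun_prop) fun p hp => h.half_mem hp.1 hp.2
    have c4 : Continuous f := by fun_prop
    exact (((c1.add c2).const_smul (1 + ε)).sub (c3.const_smul (2 : ℝ))).add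
      (c4.continuousOn.const_smul θ)
  have hFle : ∀ p ∈ Ω ×ˢ Ω, F p ≤ C + ε * (v p.1 + v p.2) + θ * f₁ := by
    intro p hp
    have h1 := hC p.1 hp.1 p.2 hp.2
    have h2 := mul_le_mul_of_nonneg_left (hff p hp).2 hθ0.le
    simp only [hF]; linarith
  obtain ⟨p, hp, hpmax⟩ := exists_isMaxOn_of_boundary (h.isBounded.prod h.isBounded) hFcont
    (p₀ := (x₀, y₀)) ⟨hx₀, hy₀⟩ (by
      intro q hq hq'
      have ht := (h.tendsto_prod hq hq').const_mul_atBot hε0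
      filter_upwards [ht.eventually_lt_atBot (F (x₀, y₀) - C - θ * f₁),
        eventually_mem_nhdsWithin] with p h1 h2
      have := hFle p h2
      linarith)
  obtain ⟨x, y⟩ := p
  obtain ⟨hx, hy⟩ : x ∈ Ω ∧ y ∈ Ω := hp
  set z := (1 / 2 : ℝ) • (x + y) with hz
  have hzΩ : z ∈ Ω := h.half_mem hx hy
  have hcm : m / 2 ≤ v x + v y - 2 * v z := by
    have h1 := hpmax (x₀, y₀) ⟨hx₀, hy₀⟩
    have h2 := mul_le_mul_of_nonneg_left (hff (x, y) ⟨hx, hy⟩).2 hθ0.le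
    have h3 : 0 < θ * f (x₀, y₀) := mul_pos hθ0 (Real.exp_pos _)
    have h4 : ε * (v x + v y) ≤ ε * (2 * |S|) := mul_le_mul_of_nonneg_left
      (by linarith [h.le_upper x hx, h.le_upper y hy, le_abs_self S]) hε0.le
    have h5 : ε * -|v x₀ + v y₀| ≤ ε * (v x₀ + v y₀) :=
      mul_le_mul_of_nonneg_left (neg_abs_le _) hε0.le
    simp only [hF] at h1
    rw [← hz] at h1
    linarith
  have hζ : ρ ≤ ‖y - x‖ := by
    by_contra! hlt'
    exact absurd (hρm x hx y hy hlt') (not_lt.mpr hcm)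
  set P := θ * K * f (x, y) with hP
  have hPlow : θ * K * f₀ ≤ P :=
    mul_le_mul_of_nonneg_left (hff (x, y) ⟨hx, hy⟩).1 (by positivity)
  have hP0 : 0 < P := lt_of_lt_of_le (by positivity) hPlow
  have hPup : P * (2 * R ^ 2) ≤ 1 := by
    have : P ≤ θ * K * f₁ := mul_le_mul_of_nonneg_left (hff (x, y) ⟨hx, hy⟩).2 (by positivity)
    calc P * (2 * R ^ 2) ≤ θ * K * f₁ * (2 * R ^ 2) :=
          mul_le_mul_of_nonneg_right this (by positivity)
      _ ≤ 1 := by linarith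
  have hsq : ∀ (w η : Euc n), HasDerivAt (fun t : ℝ => ‖w + t • η‖ ^ 2) (2 * ⟪w, η⟫) 0 := by
    intro w η
    have h1 : HasDerivAt (fun t : ℝ => w + t • η) η 0 := by
      simpa using ((hasDerivAt_id (0 : ℝ)).smul_const η).const_add w
    simpa using h1.norm_sq
  have hhalf : ∀ (η : Euc n) (t : ℝ), z + t • ((1 / 2 : ℝ) • η) = (1 / 2 : ℝ) • (x + (y + t • η)) :=
    fun η t => by rw [hz]; module
  have hhalf' : ∀ (η : Euc n) (t : ℝ), z + t • ((1 / 2 : ℝ) • η) = (1 / 2 : ℝ) • ((x + t • η) + y) :=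
    fun η t => by rw [hz]; module
  have hhalf2 : ∀ (η : Euc n) (t : ℝ), z + t • η = (1 / 2 : ℝ) • ((x + t • η) + (y + t • η)) :=
    fun η t => by rw [hz]; module
  have hXy : (1 + ε) • gradient v y = gradient v z - P • y := by
    refine ext_inner_right ℝ fun η => ?_
    have hmax : IsLocalMax (fun t : ℝ => F (x, y + t • η)) 0 := by
      filter_upwards [(tendsto_line_zero y η).eventually (h.isOpen.mem_nhds hy)] with t ht
      simpa using hpmax (x, y + t • η) ⟨hx, ht⟩
    have hd : HasDerivAt (fun t : ℝ => F (x, y + t • η))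
        ((1 + ε) * (0 + fderiv ℝ v y η) - 2 * fderiv ℝ v z ((1 / 2 : ℝ) • η)
          + θ * (f (x, y) * (K * ((2 * ⟪y, η⟫ - 0) / 2)))) 0 := by
      simp only [hF, ← hhalf]
      refine ((((hasDerivAt_const _ _).add
        (hasDerivAt_comp_line_zero (h.differentiableAt' hy))).const_mul _).sub
        ((hasDerivAt_comp_line_zero (h.differentiableAt' hzΩ)).const_mul _)).add
        (HasDerivAt.const_mul _ ?_)
      simpa [hf] using
        ((((hsq y η).sub (hasDerivAt_const _ _)).div_const 2).const_mul K).exp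
    have h0 := hmax.hasDerivAt_eq_zero hd
    simp only [inner_sub_left, real_inner_smul_left, inner_gradient_left, hP]
    simp only [map_smul, smul_eq_mul] at h0
    linarith
  have hXx : (1 + ε) • gradient v x = gradient v z + P • x := by
    refine ext_inner_right ℝ fun η => ?_
    have hmax : IsLocalMax (fun t : ℝ => F (x + t • η, y)) 0 := by
      filter_upwards [(tendsto_line_zero x η).eventually (h.isOpen.mem_nhds hx)] with t ht
      simpa using hpmax (x + t • η, y) ⟨ht, hy⟩
    have hd : HasDerivAt (fun t : ℝ => F (x + t • η, y))
        ((1 + ε) * (fderiv ℝ v x η + 0) - 2 * fderiv ℝ v z ((1 / 2 : ℝ) • η)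
          + θ * (f (x, y) * (K * ((0 - 2 * ⟪x, η⟫) / 2)))) 0 := by
      simp only [hF, ← hhalf']
      refine ((((hasDerivAt_comp_line_zero (h.differentiableAt' hx)).add
        (hasDerivAt_const _ _)).const_mul _).sub
        ((hasDerivAt_comp_line_zero (h.differentiableAt' hzΩ)).const_mul _)).add
        (HasDerivAt.const_mul _ ?_)
      simpa [hf] using
        ((((hasDerivAt_const _ _).sub (hsq x η)).div_const 2).const_mul K).exp
    have h0 := hmax.hasDerivAt_eq_zero hd
    simp only [inner_add_left, real_inner_smul_left, inner_gradient_left, hP]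
    simp only [map_smul, smul_eq_mul] at h0
    linarith
  have hlap : (1 + ε) * (lap v x + lap v y) - 2 * lap v z + P * K * ‖y - x‖ ^ 2 ≤ 0 := by
    simp only [lap, ← sum_inner_single_sq (y - x), Finset.mul_sum, ← Finset.sum_add_distrib,
      ← Finset.sum_sub_distrib]
    refine Finset.sum_nonpos fun i _ => ?_
    set η : Euc n := EuclideanSpace.single i 1
    set κ := ⟪y - x, η⟫ with hκ
    set u := (‖y‖ ^ 2 - ‖x‖ ^ 2) / 2
    have hu : ∀ t : ℝ, (‖y + t • η‖ ^ 2 - ‖x + t • η‖ ^ 2) / 2 = u + t * κ := by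
      intro t
      rw [hκ, norm_add_sq_real, norm_add_sq_real, inner_sub_left, real_inner_smul_right,
        real_inner_smul_right]
      ring
    have hmax : IsLocalMax (fun t : ℝ => F (x + t • η, y + t • η)) 0 := by
      filter_upwards [(tendsto_line_zero x η).eventually (h.isOpen.mem_nhds hx),
        (tendsto_line_zero y η).eventually (h.isOpen.mem_nhds hy)] with t ht ht'
      simpa using hpmax (x + t • η, y + t • η) ⟨ht, ht'⟩
    have hexp : ∀ t : ℝ, HasDerivAt (fun t : ℝ => Real.exp (K * (u + t * κ)))
        (Real.exp (K * (u + t * κ)) * (K * κ)) t := fun t => by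
      have := ((((hasDerivAt_id t).mul_const κ).const_add u).const_mul K).exp
      simpa using this
    simp only [hF, hf, ← hhalf2, hu] at hmax
    have h2 := hmax.second_deriv_nonpos
      (g' := fun t => (1 + ε) * (fderiv ℝ v (x + t • η) η + fderiv ℝ v (y + t • η) η)
        - 2 * fderiv ℝ v (z + t • η) η + θ * (Real.exp (K * (u + t * κ)) * (K * κ)))
      (by
        filter_upwards [(h.contDiffAt_two hx).eventually_hasDerivAt_comp_line η,
          (h.contDiffAt_two hy).eventually_hasDerivAt_comp_line η,
          (h.contDiffAt_two hzΩ).eventually_hasDerivAt_comp_line η] with t t1 t2 t3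
        exact (((t1.add t2).const_mul _).sub (t3.const_mul _)).add ((hexp t).const_mul θ))
      (((((h.contDiffAt_two hx).hasDerivAt_fderiv_comp_line η η).add
        ((h.contDiffAt_two hy).hasDerivAt_fderiv_comp_line η η)).const_mul _ |>.sub
        (((h.contDiffAt_two hzΩ).hasDerivAt_fderiv_comp_line η η).const_mul _)).add
        (((hexp 0).mul_const _).const_mul θ))
    refine le_trans (le_of_eq ?_) h2
    simp only [zero_mul, add_zero, hP, hf]
    ring
  have ex := h.lap_add x hx
  have ey := h.lap_add y hy
  have ez := h.lap_add z hzΩ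
  have hU : 2 * U z ≤ U x + U y := by
    have := h.convexOn.2 hx hy (show (0 : ℝ) ≤ 1 / 2 by norm_num)
      (show (0 : ℝ) ≤ 1 / 2 by norm_num) (by norm_num)
    rw [← smul_add, ← hz] at this
    simp only [smul_eq_mul] at this
    linarith
  have hUε : -(2 * M * ε) ≤ ε * (U x + U y) := by
    nlinarith [h.neg_le x hx, h.neg_le y hy]
  have hin := (abs_le.mp (hB x hx y hy)).1
  rw [← hz] at hin
  have nx : (1 + ε) ^ 2 * ‖gradient v x‖ ^ 2
      = ‖gradient v z‖ ^ 2 + 2 * P * ⟪gradient v z, x⟫ + P ^ 2 * ‖x‖ ^ 2 := by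
    have := congrArg (fun w => ‖w‖ ^ 2) hXx
    simp only [norm_smul, mul_pow, norm_add_sq_real, real_inner_smul_right, Real.norm_eq_abs,
      sq_abs] at this
    linarith
  have ny : (1 + ε) ^ 2 * ‖gradient v y‖ ^ 2
      = ‖gradient v z‖ ^ 2 - 2 * P * ⟪gradient v z, y⟫ + P ^ 2 * ‖y‖ ^ 2 := by
    have := congrArg (fun w => ‖w‖ ^ 2) hXy
    simp only [norm_smul, mul_pow, norm_sub_sq_real, real_inner_smul_right, Real.norm_eq_abs,
      sq_abs] at this
    linarith
  have hx2 : ‖x‖ ^ 2 ≤ R ^ 2 := pow_le_pow_left₀ (norm_nonneg _) (hR _ hx) 2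
  have hy2 : ‖y‖ ^ 2 ≤ R ^ 2 := pow_le_pow_left₀ (norm_nonneg _) (hR _ hy) 2
  rw [inner_sub_right] at hin
  set N := ‖gradient v x‖ ^ 2 + ‖gradient v y‖ ^ 2 with hN
  have hN2 : (1 + ε) ^ 2 * N ≤ 2 * ‖gradient v z‖ ^ 2 + 2 * P * B + P := by
    have : P ^ 2 * (‖x‖ ^ 2 + ‖y‖ ^ 2) ≤ P := by
      nlinarith [mul_le_mul_of_nonneg_left hPup hP0.le,
        mul_le_mul_of_nonneg_left (add_le_add hx2 hy2) (sq_nonneg P)]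
    nlinarith [mul_le_mul_of_nonneg_left hin hP0.le]
  have hN1 : (1 + ε) * N ≤ 2 * ‖gradient v z‖ ^ 2 + 2 * P * B + P := by
    have : 0 ≤ N := by positivity
    nlinarith [mul_nonneg (mul_nonneg hε0.le (by linarith : (0 : ℝ) ≤ 1 + ε)) this]
  have hKζ : 2 * B + 2 ≤ K * ‖y - x‖ ^ 2 := by
    have : K * ρ ^ 2 = 2 * B + 2 := by rw [hK]; field_simp
    rw [← this]
    gcongr
  have hPK : P * (2 * B + 2) ≤ P * K * ‖y - x‖ ^ 2 := by
    have := mul_le_mul_of_nonneg_left hKζ hP0.le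
    linarith only [this]
  have e1 : lap v x + lap v y = U x + U y - N := by rw [hN]; linarith
  have e2 : lap v z = U z - ‖gradient v z‖ ^ 2 := by linarith
  rw [e1, e2] at hlap
  nlinarith

end IsLogGroundState

end LogConcavity

section Modulus

variable {n : ℕ}

theorem hasDerivAt_norm_line {w : Euc n} (hw : w ≠ 0) (η : Euc n) :
    HasDerivAt (fun t : ℝ => ‖w + t • η‖) (⟪w, η⟫ / ‖w‖) 0 := by
  have h1 : HasDerivAt (fun t : ℝ => w + t • η) η 0 := by
    simpa using ((hasDerivAt_id (0 : ℝ)).smul_const η).const_add w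
  have h2 : HasDerivAt (fun t : ℝ => ‖w + t • η‖ ^ 2) (2 * ⟪w, η⟫) 0 := by
    simpa using h1.norm_sq
  have h3 := h2.sqrt (by simpa using hw)
  simp only [Real.sqrt_sq (norm_nonneg _), zero_smul, add_zero] at h3
  convert h3 using 1
  have : ‖w‖ ≠ 0 := by simpa using hw
  field_simp

theorem ConvexOn.fderiv_sub_nonneg {Ω : Set (Euc n)} {U : Euc n → ℝ} (hU : ConvexOn ℝ Ω U)
    {x y : Euc n} (hx : x ∈ Ω) (hy : y ∈ Ω) (hdx : DifferentiableAt ℝ U x)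
    (hdy : DifferentiableAt ℝ U y) : fderiv ℝ U x (y - x) ≤ fderiv ℝ U y (y - x) := by
  have hc := hU.comp_affineMap (AffineMap.lineMap x y : ℝ →ᵃ[ℝ] Euc n)
  have hl : ∀ t : ℝ, (AffineMap.lineMap x y : ℝ →ᵃ[ℝ] Euc n) t = x + t • (y - x) := fun t => by
    rw [AffineMap.lineMap_apply_module']; abel
  have h0 : HasDerivAt (U ∘ (AffineMap.lineMap x y : ℝ →ᵃ[ℝ] Euc n)) (fderiv ℝ U x (y - x)) 0 := by
    simpa [Function.comp_def, hl] using hasDerivAt_comp_line_zero (η := y - x) hdx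
  have h1 : HasDerivAt (U ∘ (AffineMap.lineMap x y : ℝ →ᵃ[ℝ] Euc n)) (fderiv ℝ U y (y - x)) 1 := by
    simpa [Function.comp_def, hl] using
      hasDerivAt_comp_line (f := U) (x := x) (η := y - x) (t := 1) (by simpa using hdy)
  have m0 : (0 : ℝ) ∈ (AffineMap.lineMap x y : ℝ →ᵃ[ℝ] Euc n) ⁻¹' Ω := by simpa using hx
  have m1 : (1 : ℝ) ∈ (AffineMap.lineMap x y : ℝ →ᵃ[ℝ] Euc n) ⁻¹' Ω := by simpa using hy
  exact (hc.le_slope_of_hasDerivAt m0 m1 one_pos h0).trans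
    (hc.slope_le_of_hasDerivAt m0 m1 one_pos h1)

namespace IsLogGroundState

variable {Ω : Set (Euc n)} {v U : Euc n → ℝ} {M S : ℝ}

theorem second_deriv_nonpos (h : IsLogGroundState Ω v U M S)
    (hmid : ∀ x ∈ Ω, ∀ y ∈ Ω, v x + v y ≤ 2 * v ((1 / 2 : ℝ) • (x + y)))
    {z : Euc n} (hz : z ∈ Ω) (ξ : Euc n) :
    fderiv ℝ (fun y => fderiv ℝ v y ξ) z ξ ≤ 0 := by
  have hmax : IsLocalMax (fun t : ℝ => v (z + t • ξ) + v (z + t • (-ξ))) 0 := by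
    filter_upwards [(tendsto_line_zero z ξ).eventually (h.isOpen.mem_nhds hz),
      (tendsto_line_zero z (-ξ)).eventually (h.isOpen.mem_nhds hz)] with t h1 h2
    have h3 := hmid _ h1 _ h2
    have h4 : (1 / 2 : ℝ) • ((z + t • ξ) + (z + t • (-ξ))) = z := by module
    rw [h4] at h3
    simp only [zero_smul, add_zero]
    linarith
  have h2 := hmax.second_deriv_nonpos
    (g' := fun t => fderiv ℝ v (z + t • ξ) ξ + fderiv ℝ v (z + t • (-ξ)) (-ξ))
    (by
      filter_upwards [(h.contDiffAt_two hz).eventually_hasDerivAt_comp_line ξ,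
        (h.contDiffAt_two hz).eventually_hasDerivAt_comp_line (-ξ)] with t t1 t2
      exact t1.add t2)
    (((h.contDiffAt_two hz).hasDerivAt_fderiv_comp_line ξ ξ).add
      ((h.contDiffAt_two hz).hasDerivAt_fderiv_comp_line (-ξ) (-ξ)))
  rw [(h.contDiffAt_two hz).fderiv_fderiv_apply, (h.contDiffAt_two hz).fderiv_fderiv_apply] at h2
  rw [(h.contDiffAt_two hz).fderiv_fderiv_apply]
  simp only [map_neg, neg_apply, neg_neg] at h2
  linarith

theorem gradient_antitone (h : IsLogGroundState Ω v U M S)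
    (hmid : ∀ x ∈ Ω, ∀ y ∈ Ω, v x + v y ≤ 2 * v ((1 / 2 : ℝ) • (x + y)))
    {x y : Euc n} (hx : x ∈ Ω) (hy : y ∈ Ω) :
    fderiv ℝ v y (y - x) ≤ fderiv ℝ v x (y - x) := by
  have hmem : ∀ t ∈ Icc (0 : ℝ) 1, x + t • (y - x) ∈ Ω := fun t ht =>
    h.convexOn.1.add_smul_sub_mem hx hy ht
  have hd : ∀ t ∈ Icc (0 : ℝ) 1, HasDerivAt (fun t : ℝ => fderiv ℝ v (x + t • (y - x)) (y - x))
      (fderiv ℝ (fun z => fderiv ℝ v z (y - x)) (x + t • (y - x)) (y - x)) t := fun t ht =>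
    hasDerivAt_comp_line (f := fun z => fderiv ℝ v z (y - x))
      (((h.contDiffAt_two (hmem t ht)).fderiv_apply (m := 1) (by norm_num)
        (y - x)).differentiableAt (by simp))
  have hanti := antitoneOn_of_deriv_nonpos (convex_Icc (0 : ℝ) 1)
    (fun t ht => (hd t ht).continuousAt.continuousWithinAt)
    (fun t ht => (hd t (interior_subset ht)).differentiableAt.differentiableWithinAt)
    (fun t ht => by
      rw [(hd t (interior_subset ht)).deriv]
      exact h.second_deriv_nonpos hmid (hmem t (interior_subset ht)) _)
  have := hanti (left_mem_Icc.mpr zero_le_one) (right_mem_Icc.mpr zero_le_one) zero_le_one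
  simpa using this

theorem lap_fderiv (h : IsLogGroundState Ω v U M S) {x : Euc n} (hx : x ∈ Ω) (e : Euc n) :
    lap (fun y => fderiv ℝ v y e) x =
      fderiv ℝ U x e - 2 * fderiv ℝ (fun y => fderiv ℝ v y e) x (gradient v x) := by
  have hv := h.contDiffAt_two hx
  have hd : ∀ η : Euc n, DifferentiableAt ℝ (fun y => fderiv ℝ v y η) x := fun η =>
    (hv.fderiv_apply (m := 1) (by norm_num) η).differentiableAt (by simp)
  have heq : lap v =ᶠ[𝓝 x] fun y => U y - ∑ i, fderiv ℝ v y (EuclideanSpace.single i (1 : ℝ)) *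
      fderiv ℝ v y (EuclideanSpace.single i (1 : ℝ)) := by
    filter_upwards [h.isOpen.mem_nhds hx] with y hy
    rw [sum_fderiv_single_mul, real_inner_self_eq_norm_sq, ← h.lap_add y hy]
    ring
  rw [lap_fderiv_apply (h.contDiffAt x hx), heq.fderiv_eq,
    fderiv_fun_sub (h.differentiableAt x hx) (DifferentiableAt.fun_sum fun i _ =>
      (hd _).fun_mul (hd _)), fderiv_fun_sum fun i _ => (hd _).fun_mul (hd _)]
  have : ⟪gradient v x, gradient (fun y => fderiv ℝ v y e) x⟫ =
      fderiv ℝ (fun y => fderiv ℝ v y e) x (gradient v x) := by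
    rw [real_inner_comm, inner_gradient_left]
  rw [← this, ← sum_fderiv_single_mul]
  simp only [sub_apply, sum_apply, Finset.mul_sum]
  congr 1
  refine Finset.sum_congr rfl fun i _ => ?_
  rw [fderiv_fun_mul (hd _) (hd _)]
  simp only [add_apply, smul_apply, smul_eq_mul]
  rw [hv.fderiv_fderiv_comm _ e]
  ring

end IsLogGroundState

/-- First-order condition at a spatial maximum of the modulus-of-concavity function. -/
theorem fderiv_fderiv_eq_of_isLocalMax {v : Euc n → ℝ} {x y e : Euc n} {r ε : ℝ} {T : ℝ → ℝ}
    {T' : ℝ} (hv : ContDiffAt ℝ 2 v y) (hr : 0 < r) (he : ‖e‖ = 1) (hre : y - x = r • e)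
    (hT : HasDerivAt T T' r) (η : Euc n)
    (hmax : IsLocalMax (fun t : ℝ => (fderiv ℝ v (y + t • η) (y + t • η - x) -
      fderiv ℝ v x (y + t • η - x)) / ‖y + t • η - x‖ + T ‖y + t • η - x‖
        + ε * v (y + t • η)) 0) :
    fderiv ℝ (fun z => fderiv ℝ v z e) y η =
      ((fderiv ℝ v y e - fderiv ℝ v x e) * ⟪e, η⟫ - (fderiv ℝ v y η - fderiv ℝ v x η)) / r
        - T' * ⟪e, η⟫ - ε * fderiv ℝ v y η := by
  have hne : r • e ≠ 0 := by
    intro h0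
    rcases smul_eq_zero.mp h0 with h0 | h0
    · exact hr.ne' h0
    · simp [h0] at he
  have hnr : ‖r • e‖ = r := by rw [norm_smul, he, mul_one, Real.norm_of_nonneg hr.le]
  have hline : ∀ t : ℝ, y + t • η - x = r • e + t • η := fun t => by rw [← hre]; abel
  have hN := hasDerivAt_norm_line hne η
  rw [hnr, real_inner_smul_left, mul_div_cancel_left₀ _ hr.ne'] at hN
  have hlin : ∀ (t : ℝ) (L : Euc n →L[ℝ] ℝ), L (r • e + t • η) = r * L e + t * L η := by
    intro t L; simp
  have h1 : HasDerivAt (fun t : ℝ => r * fderiv ℝ v (y + t • η) e + t * fderiv ℝ v (y + t • η) η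
      - (r * fderiv ℝ v x e + t * fderiv ℝ v x η))
      (r * fderiv ℝ (fun z => fderiv ℝ v z e) y η + (1 * fderiv ℝ v (y + (0 : ℝ) • η) η
        + 0 * fderiv ℝ (fun z => fderiv ℝ v z η) y η) - (0 + 1 * fderiv ℝ v x η)) 0 :=
    (((hv.hasDerivAt_fderiv_comp_line η e).const_mul r).add
      ((hasDerivAt_id' (0 : ℝ)).mul (hv.hasDerivAt_fderiv_comp_line η η))).sub
      ((hasDerivAt_const _ _).add ((hasDerivAt_id' (0 : ℝ)).mul_const _))
  have hT0 : HasDerivAt T T' ‖r • e + (0 : ℝ) • η‖ := by simpa [hnr] using hT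
  have hd := ((h1.div hN (by simpa using hne)).add (hT0.comp (0 : ℝ) hN)).add
    ((hasDerivAt_comp_line_zero (η := η) (hv.differentiableAt (by simp))).const_mul ε)
  simp only [hline, hlin] at hmax
  have h0 := hmax.hasDerivAt_eq_zero hd
  simp only [zero_smul, add_zero, hnr, zero_mul, one_mul, zero_add] at h0
  field_simp at h0 ⊢
  linarith

end Modulus

section ModulusOfConcavity

variable {n : ℕ}

theorem hasDerivAt_two_mul_tan {a r : ℝ} (hr : 0 ≤ a * r) (har : a * r < Real.pi) :
    HasDerivAt (fun s : ℝ => 2 * a * Real.tan (a * s / 2))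
      (a ^ 2 + (2 * a * Real.tan (a * r / 2)) ^ 2 / 4) r := by
  have hcos : Real.cos (a * r / 2) ≠ 0 := by
    apply ne_of_gt
    apply Real.cos_pos_of_mem_Ioo
    constructor <;> linarith [Real.pi_pos]
  have h1 : HasDerivAt (fun s : ℝ => a * s / 2) (a / 2) r := by
    simpa using ((hasDerivAt_id r).const_mul a).div_const 2
  have h2 := ((Real.hasDerivAt_tan hcos).comp r h1).const_mul (2 * a)
  refine h2.congr_deriv ?_
  have := Real.sin_sq_add_cos_sq (a * r / 2)
  rw [Real.tan_eq_sin_div_cos]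
  field_simp
  linear_combination (-4 * a ^ 2) * this

theorem hasDerivAt_two_mul_tan' {a r : ℝ} (hr : 0 ≤ a * r) (har : a * r < Real.pi) :
    HasDerivAt (fun s : ℝ => a ^ 2 + (2 * a * Real.tan (a * s / 2)) ^ 2 / 4)
      (2 * a * Real.tan (a * r / 2) * (a ^ 2 + (2 * a * Real.tan (a * r / 2)) ^ 2 / 4) / 2) r := by
  refine ((((hasDerivAt_two_mul_tan hr har).pow 2).div_const 4).const_add (a ^ 2)).congr_deriv ?_
  push_cast
  ring

theorem exists_isMaxOn_prod_ne {Ω : Set (Euc n)} {v : Euc n → ℝ} (hbdd : Bornology.IsBounded Ω)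
    {F : Euc n × Euc n → ℝ}
    (hv : ∀ q ∈ closure (Ω ×ˢ Ω), q ∉ Ω ×ˢ Ω →
      Tendsto (fun p : Euc n × Euc n => v p.1 + v p.2) (𝓝[Ω ×ˢ Ω] q) atBot)
    (hF : ContinuousOn F {p | p ∈ Ω ×ˢ Ω ∧ p.1 ≠ p.2}) {p₀ : Euc n × Euc n}
    (hp₀ : p₀ ∈ Ω ×ˢ Ω) (hp₀' : p₀.1 ≠ p₀.2) {c ε : ℝ} (hε : 0 < ε)
    (hle : ∀ p ∈ Ω ×ˢ Ω, p.1 ≠ p.2 → F p ≤ c + ε * (v p.1 + v p.2)) {g : ℝ → ℝ}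
    (hg : Tendsto g (𝓝 0) (𝓝 0)) {c' : ℝ} (hc' : c' < F p₀)
    (hle' : ∀ p ∈ Ω ×ˢ Ω, p.1 ≠ p.2 → F p ≤ g ‖p.2 - p.1‖ + c') :
    ∃ x ∈ Ω, ∃ y ∈ Ω, x ≠ y ∧ ∀ x' ∈ Ω, ∀ y' ∈ Ω, x' ≠ y' → F (x', y') ≤ F (x, y) := by
  obtain ⟨p, hp, hmax⟩ := exists_isMaxOn_of_boundary
    ((hbdd.prod hbdd).subset fun p hp => hp.1 : Bornology.IsBounded {p | p ∈ Ω ×ˢ Ω ∧ p.1 ≠ p.2})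
    hF (p₀ := p₀) ⟨hp₀, hp₀'⟩ (by
      intro q hq hq'
      by_cases hqΩ : q ∈ Ω ×ˢ Ω
      · have hqq : q.1 = q.2 := by
          by_contra hne
          exact hq' ⟨hqΩ, hne⟩
        have ht : Tendsto (fun p : Euc n × Euc n => ‖p.2 - p.1‖) (𝓝 q) (𝓝 0) := by
          have : Continuous fun p : Euc n × Euc n => ‖p.2 - p.1‖ := by fun_prop
          simpa [hqq] using this.tendsto q
        filter_upwards [((hg.comp ht).mono_left nhdsWithin_le_nhds).eventually
          (gt_mem_nhds (sub_pos.mpr hc')), eventually_mem_nhdsWithin] with p h1 h2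
        have := hle' p h2.1 h2.2
        simp only [Function.comp_apply] at h1
        linarith
      · have ht := ((hv q (closure_mono (fun p hp => hp.1) hq) hqΩ).const_mul_atBot hε).mono_left
          (nhdsWithin_mono q fun p (hp : p ∈ {p | p ∈ Ω ×ˢ Ω ∧ p.1 ≠ p.2}) => hp.1)
        filter_upwards [ht.eventually_lt_atBot (F p₀ - c), eventually_mem_nhdsWithin] with p h1 h2
        have := hle p h2.1 h2.2
        linarith)
  exact ⟨p.1, hp.1.1, p.2, hp.1.2, hp.2, fun x' hx' y' hy' hne => hmax (x', y') ⟨⟨hx', hy'⟩, hne⟩⟩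

namespace IsLogGroundState

variable {Ω : Set (Euc n)} {v U : Euc n → ℝ} {M S : ℝ}

set_option maxHeartbeats 1000000 in
/-- The sharp modulus of concavity for the logarithm of the ground state. -/
theorem modulus_of_concavity (h : IsLogGroundState Ω v U M S)
    (hmono : ∀ x ∈ Ω, ∀ y ∈ Ω, fderiv ℝ v y (y - x) ≤ fderiv ℝ v x (y - x))
    {a D : ℝ} (ha : 0 < a) (haD : a * D < Real.pi) (hD : ∀ x ∈ Ω, ∀ y ∈ Ω, ‖y - x‖ ≤ D)
    {x₀ y₀ : Euc n} (hx₀ : x₀ ∈ Ω) (hy₀ : y₀ ∈ Ω) (hne₀ : x₀ ≠ y₀) :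
    (fderiv ℝ v y₀ (y₀ - x₀) - fderiv ℝ v x₀ (y₀ - x₀)) / ‖y₀ - x₀‖
      + 2 * a * Real.tan (a * ‖y₀ - x₀‖ / 2) ≤ 0 := by
  by_contra! hlt
  set T : ℝ → ℝ := fun s => 2 * a * Real.tan (a * s / 2) with hTdef
  set Z : Euc n → Euc n → ℝ := fun x y =>
    (fderiv ℝ v y (y - x) - fderiv ℝ v x (y - x)) / ‖y - x‖ + T ‖y - x‖ with hZ
  set m := Z x₀ y₀ with hm
  have hm0 : 0 < m := hlt
  have hr : ∀ x ∈ Ω, ∀ y ∈ Ω, 0 ≤ a * ‖y - x‖ ∧ a * ‖y - x‖ < Real.pi := fun x hx y hy =>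
    ⟨by positivity, (mul_le_mul_of_nonneg_left (hD x hx y hy) ha.le).trans_lt haD⟩
  obtain ⟨ε, hε0, hε1, hε2⟩ := exists_pos_mul_lt_and (show 0 < m / 4 by positivity)
    (show 0 < a ^ 2 * m / 2 by positivity) (|v x₀ + v y₀| + 2 * |S|) M
  have hεv : -(m / 4) < ε * (v x₀ + v y₀) := by
    have h5 : ε * -|v x₀ + v y₀| ≤ ε * (v x₀ + v y₀) :=
      mul_le_mul_of_nonneg_left (neg_abs_le _) hε0.le
    have : 0 ≤ ε * (2 * |S|) := by positivity
    linarith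
  have hεS : ∀ x ∈ Ω, ∀ y ∈ Ω, ε * (v x + v y) ≤ m / 4 := fun x hx y hy => by
    have h4 : ε * (v x + v y) ≤ ε * (2 * |S|) := mul_le_mul_of_nonneg_left
      (by linarith [h.le_upper x hx, h.le_upper y hy, le_abs_self S]) hε0.le
    have : 0 ≤ ε * |v x₀ + v y₀| := by positivity
    linarith
  have hTle : ∀ x ∈ Ω, ∀ y ∈ Ω, T ‖y - x‖ ≤ T D := fun x hx y hy => by
    have h1 := hr x hx y hy
    have h2 := hD x hx y hy
    refine mul_le_mul_of_nonneg_left ?_ (by positivity)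
    refine Real.strictMonoOn_tan.monotoneOn ?_ ?_ ?_
    · constructor <;> linarith [Real.pi_pos]
    · constructor <;> linarith [Real.pi_pos, mul_le_mul_of_nonneg_left h2 ha.le]
    · linarith [mul_le_mul_of_nonneg_left h2 ha.le]
  have hZT : ∀ x ∈ Ω, ∀ y ∈ Ω, Z x y ≤ T ‖y - x‖ := fun x hx y hy => by
    have : (fderiv ℝ v y (y - x) - fderiv ℝ v x (y - x)) / ‖y - x‖ ≤ 0 :=
      div_nonpos_of_nonpos_of_nonneg (by linarith [hmono x hx y hy]) (norm_nonneg _)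
    simp only [hZ]; linarith
  have hfc : ContinuousOn (fderiv ℝ v) Ω := fun x hx =>
    ((h.contDiffAt_two hx).fderiv_right (m := 1) (by norm_num)).continuousAt.continuousWithinAt
  obtain ⟨x, hx, y, hy, hxy, hmax⟩ := exists_isMaxOn_prod_ne (v := v) h.isBounded
    (F := fun p => Z p.1 p.2 + ε * (v p.1 + v p.2)) (fun q hq hq' => h.tendsto_prod hq hq')
    (by
      have i1 : MapsTo (fun p : Euc n × Euc n => p.1) {p | p ∈ Ω ×ˢ Ω ∧ p.1 ≠ p.2} Ω :=
        fun p hp => hp.1.1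
      have i2 : MapsTo (fun p : Euc n × Euc n => p.2) {p | p ∈ Ω ×ˢ Ω ∧ p.1 ≠ p.2} Ω :=
        fun p hp => hp.1.2
      have cd : ContinuousOn (fun p : Euc n × Euc n => p.2 - p.1) {p | p ∈ Ω ×ˢ Ω ∧ p.1 ≠ p.2} :=
        by fun_prop
      have c1 := h.continuousOn.comp continuousOn_fst i1
      have c2 := h.continuousOn.comp continuousOn_snd i2
      have c3 := (hfc.comp continuousOn_fst i1).clm_apply cd
      have c4 := (hfc.comp continuousOn_snd i2).clm_apply cd
      have c5 : ContinuousOn (fun p : Euc n × Euc n => T ‖p.2 - p.1‖)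
          {p | p ∈ Ω ×ˢ Ω ∧ p.1 ≠ p.2} := fun p hp =>
        ContinuousAt.comp_continuousWithinAt (g := T)
          (hasDerivAt_two_mul_tan (hr _ hp.1.1 _ hp.1.2).1
            (hr _ hp.1.1 _ hp.1.2).2).continuousAt (cd.norm p hp)
      exact (((c4.sub c3).div cd.norm fun p hp =>
        norm_ne_zero_iff.mpr (sub_ne_zero.mpr hp.2.symm)).add c5).add
          ((c1.add c2).const_smul ε))
    (p₀ := (x₀, y₀)) ⟨hx₀, hy₀⟩ hne₀ (c := T D) hε0
    (fun p hp _ => by linarith [hZT p.1 hp.1 p.2 hp.2, hTle p.1 hp.1 p.2 hp.2]) (g := T)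
    (by
      have := (hasDerivAt_two_mul_tan (a := a) (r := 0) (by simp)
        (by simpa using Real.pi_pos)).continuousAt.tendsto
      simpa [hTdef] using this) (c' := m / 4) (by simp only [← hm]; linarith)
    (fun p hp _ => by linarith [hZT p.1 hp.1 p.2 hp.2, hεS p.1 hp.1 p.2 hp.2])
  have hmax0 := hmax x₀ hx₀ y₀ hy₀ hne₀
  simp only [← hm] at hmax0
  set r := ‖y - x‖ with hrdef
  have hr0 : 0 < r := norm_pos_iff.mpr (sub_ne_zero.mpr hxy.symm)
  obtain ⟨e, he, hre⟩ : ∃ e : Euc n, ‖e‖ = 1 ∧ y - x = r • e :=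
    ⟨r⁻¹ • (y - x), by rw [norm_smul, ← hrdef, norm_inv, norm_norm]; exact inv_mul_cancel₀ hr0.ne',
      by rw [smul_smul, mul_inv_cancel₀ hr0.ne', one_smul]⟩
  have hT1 := hasDerivAt_two_mul_tan (hr x hx y hy).1 (hr x hx y hy).2
  have hT2 := hasDerivAt_two_mul_tan' (hr x hx y hy).1 (hr x hx y hy).2
  have hTr : 2 * a * Real.tan (a * r / 2) = T r := rfl
  rw [← hrdef, hTr] at hT1 hT2
  set T' := a ^ 2 + T r ^ 2 / 4 with hT'
  have hvx := h.contDiffAt_two hx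
  have hvy := h.contDiffAt_two hy
  set k := fderiv ℝ v y e - fderiv ℝ v x e with hk
  have hZxy : Z x y = k + T r := by
    simp only [hZ, hre, map_smul, smul_eq_mul, hk, norm_smul, he, mul_one,
      Real.norm_of_nonneg hr0.le]
    field_simp
  have hq : m / 2 ≤ k + T r := by
    rw [← hZxy]
    linarith [hεS x hx y hy]
  have hHy := fderiv_fderiv_eq_of_isLocalMax (ε := ε) hvy hr0 he hre hT1 (gradient v y) (by
    filter_upwards [(tendsto_line_zero y (gradient v y)).eventually (h.isOpen.mem_nhds hy),
      (tendsto_line_zero y (gradient v y)).eventually_ne hxy.symm] with t h1 h2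
    have := hmax x hx _ h1 h2.symm
    simp only [zero_smul, add_zero]
    simp only [hZ] at this ⊢
    linarith)
  have hHx := fderiv_fderiv_eq_of_isLocalMax (x := y) (e := -e) (ε := ε) hvx hr0 (by simpa using he)
    (by rw [smul_neg, ← hre]; abel) hT1 (gradient v x) (by
    filter_upwards [(tendsto_line_zero x (gradient v x)).eventually (h.isOpen.mem_nhds hx),
      (tendsto_line_zero x (gradient v x)).eventually_ne hxy] with t h1 h2
    have := hmax _ h1 y hy h2
    simp only [zero_smul, add_zero]
    simp only [hZ] at this ⊢
    have hs : ∀ w : Euc n, y - w = -(w - y) := fun w => by abel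
    rw [← hrdef, hs, hs x, norm_neg] at this
    rw [hrdef, hs x, norm_neg] at this
    simp only [map_neg] at this
    rw [show ∀ A B : ℝ, -A - -B = B - A from fun A B => by ring,
      show ∀ A B : ℝ, -A - -B = B - A from fun A B => by ring] at this
    linarith)
  have hneg : (fun z => fderiv ℝ v z (-e)) = fun z => -fderiv ℝ v z e := by
    funext z; simp
  rw [hneg, fderiv_fun_neg] at hHx
  simp only [neg_apply, map_neg, inner_neg_left] at hHx
  have hlap := lap_sub_lap_le (f₁ := fun z => fderiv ℝ v z e + ε * v z)
    (f₂ := fun z => fderiv ℝ v z e + -ε * v z) (x := x) (y := y)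
    (((h.contDiffAt y hy).fderiv_apply (by norm_num) e).add (contDiffAt_const.mul hvy))
    (((h.contDiffAt x hx).fderiv_apply (by norm_num) e).add (contDiffAt_const.mul hvx)) he
    (Φ := fun s => -(2 * a * Real.tan (a * s / 2)))
    (Φ' := fun s => -(a ^ 2 + (2 * a * Real.tan (a * s / 2)) ^ 2 / 4)) (r := r)
    (by
      have g1 : ∀ᶠ s in 𝓝 r, a * s < Real.pi :=
        (continuous_const.mul continuous_id).continuousAt.eventually_lt continuousAt_const
          (by simpa using (hr x hx y hy).2)
      filter_upwards [g1, lt_mem_nhds hr0] with s g1 g2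
      exact (hasDerivAt_two_mul_tan (by positivity) g1).neg) hT2.neg
    (fun η => by
      filter_upwards [eventually_reflected_motion h.isOpen hx hy he hr0 hre η]
        with t ⟨hx', hy', hr', he', hn'⟩
      have hne' : x + t • (η - (2 * ⟪e, η⟫) • e) ≠ y + t • η := by
        intro heq
        rw [heq, sub_self, norm_zero] at hn'
        exact hr'.ne hn'
      have := hmax _ hx' _ hy' hne'
      dsimp only at this
      rw [hZxy] at this
      simp only [hZ] at this
      rw [hn', he'] at this
      simp only [map_smul, smul_eq_mul, ← mul_sub] at this
      rw [mul_div_cancel_left₀ _ hr'.ne'] at this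
      simp only [zero_smul, add_zero, zero_mul, hTr]
      simp only [hTdef, hk] at this ⊢
      linarith)
  rw [lap_add_smul ((h.contDiffAt y hy).fderiv_apply (by norm_num) e) hvy,
    lap_add_smul ((h.contDiffAt x hx).fderiv_apply (by norm_num) e) hvx, h.lap_fderiv hy,
    h.lap_fderiv hx] at hlap
  have hUconv := h.convexOn.fderiv_sub_nonneg hx hy (h.differentiableAt x hx)
    (h.differentiableAt y hy)
  rw [hre, map_smul, map_smul, smul_eq_mul, smul_eq_mul, mul_le_mul_iff_right₀ hr0] at hUconv
  have ex := h.lap_add x hx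
  have ey := h.lap_add y hy
  have hMx := h.neg_le x hx
  have hMy := h.neg_le y hy
  have hcs : k ^ 2 ≤ ‖gradient v y - gradient v x‖ ^ 2 := by
    have h1 : k = ⟪gradient v y - gradient v x, e⟫ := by
      rw [inner_sub_left, inner_gradient_left, inner_gradient_left]
    rw [h1, ← sq_abs]
    exact pow_le_pow_left₀ (abs_nonneg _) ((abs_real_inner_le_norm _ _).trans (by rw [he, mul_one])) 2
  have hke : k = ⟪e, gradient v y⟫ - ⟪e, gradient v x⟫ := by
    rw [real_inner_comm, real_inner_comm (gradient v x), inner_gradient_left, inner_gradient_left]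
  have gy : fderiv ℝ v y (gradient v y) = ‖gradient v y‖ ^ 2 := by
    rw [← inner_gradient_left, real_inner_self_eq_norm_sq]
  have gx : fderiv ℝ v x (gradient v x) = ‖gradient v x‖ ^ 2 := by
    rw [← inner_gradient_left, real_inner_self_eq_norm_sq]
  have gyx : fderiv ℝ v y (gradient v x) = ⟪gradient v y, gradient v x⟫ := by
    rw [← inner_gradient_left]
  have gxy : fderiv ℝ v x (gradient v y) = ⟪gradient v y, gradient v x⟫ := by
    rw [← inner_gradient_left, real_inner_comm]
  rw [norm_sub_sq_real] at hcs
  rw [gy, gxy, ← hk] at hHy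
  rw [gx, gyx, show -(fderiv ℝ v x) e - -(fderiv ℝ v y) e = k by rw [hk]; ring] at hHx
  have hdiff : fderiv ℝ (fun z => fderiv ℝ v z e) y (gradient v y)
      - fderiv ℝ (fun z => fderiv ℝ v z e) x (gradient v x)
      ≤ -(T' * k) - ε * (‖gradient v y‖ ^ 2 + ‖gradient v x‖ ^ 2) := by
    have h1 : (k ^ 2 - (‖gradient v y‖ ^ 2 - 2 * ⟪gradient v y, gradient v x⟫
        + ‖gradient v x‖ ^ 2)) / r ≤ 0 := div_nonpos_of_nonpos_of_nonneg (by linarith) hr0.le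
    have h2 : fderiv ℝ (fun z => fderiv ℝ v z e) y (gradient v y)
      - fderiv ℝ (fun z => fderiv ℝ v z e) x (gradient v x) = (k ^ 2 - (‖gradient v y‖ ^ 2
        - 2 * ⟪gradient v y, gradient v x⟫ + ‖gradient v x‖ ^ 2)) / r - T' * k
        - ε * (‖gradient v y‖ ^ 2 + ‖gradient v x‖ ^ 2) := by
      rw [sub_eq_add_neg, hHy, hHx, sq k]
      nth_rewrite 5 [hke]
      nth_rewrite 4 [hke]
      field_simp
      ring
    linarith
  have hT'a : a ^ 2 ≤ T' := by
    rw [hT']; linarith [sq_nonneg (T r)]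
  have hMx' := mul_le_mul_of_nonneg_left hMx hε0.le
  have hMy' := mul_le_mul_of_nonneg_left hMy hε0.le
  rw [← ex] at hMx'
  rw [← ey] at hMy'
  have hlast : T' * (k + T r) ≤ ε * M := by
    have hpos : 0 ≤ ε * (‖gradient v y‖ ^ 2 + ‖gradient v x‖ ^ 2) := by positivity
    linarith only [hlap, hdiff, hUconv, hMx', hMy', hpos]
  have : a ^ 2 * (m / 2) ≤ T' * (k + T r) :=
    mul_le_mul hT'a hq (by positivity) (by positivity)
  linarith

end IsLogGroundState

end ModulusOfConcavity

section GapComparison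

variable {n : ℕ}

/-- One-dimensional comparison function, with `4 f'' = -3 a² f + 4 a tan (a s / 2) f'`. -/
noncomputable def gapProfile (a κ s : ℝ) : ℝ :=
  2 * Real.sin (a * s / 2) + κ * (2 * Real.cos (a * s / 2) - (Real.cos (a * s / 2))⁻¹)

/-- The derivative of `gapProfile`. -/
noncomputable def gapProfileDeriv (a κ s : ℝ) : ℝ :=
  a / 2 * (2 * Real.cos (a * s / 2) -
    κ * (2 * Real.sin (a * s / 2) + Real.sin (a * s / 2) / Real.cos (a * s / 2) ^ 2))

theorem hasDerivAt_gapProfile {a κ r : ℝ} (hr : Real.cos (a * r / 2) ≠ 0) :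
    HasDerivAt (gapProfile a κ) (gapProfileDeriv a κ r) r := by
  have h1 : HasDerivAt (fun s : ℝ => a * s / 2) (a / 2) r := by
    simpa using ((hasDerivAt_id r).const_mul a).div_const 2
  refine ((h1.sin.const_mul 2).add (((h1.cos.const_mul 2).sub
    (h1.cos.inv hr)).const_mul κ)).congr_deriv ?_
  rw [gapProfileDeriv]
  field_simp
  ring

theorem hasDerivAt_gapProfileDeriv {a κ r : ℝ} (hr : Real.cos (a * r / 2) ≠ 0) :
    HasDerivAt (gapProfileDeriv a κ) ((-3 * a ^ 2 * gapProfile a κ r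
      + 2 * (2 * a * Real.tan (a * r / 2)) * gapProfileDeriv a κ r) / 4) r := by
  have h1 : HasDerivAt (fun s : ℝ => a * s / 2) (a / 2) r := by
    simpa using ((hasDerivAt_id r).const_mul a).div_const 2
  refine (((h1.cos.const_mul 2).sub (((h1.sin.const_mul 2).add
    (h1.sin.div (h1.cos.pow 2) (pow_ne_zero 2 hr))).const_mul κ)).const_mul (a / 2)).congr_deriv ?_
  rw [gapProfileDeriv, gapProfile, Real.tan_eq_sin_div_cos]
  have h2 : Real.sin (a * r / 2) ^ 2 = 1 - Real.cos (a * r / 2) ^ 2 := Real.sin_sq _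
  simp only [Pi.pow_apply]
  generalize Real.sin (a * r / 2) = σ at *
  generalize Real.cos (a * r / 2) = c at *
  field_simp
  push_cast
  ring_nf
  simp only [h2]
  ring

theorem gapProfileDeriv_nonneg {a D : ℝ} (ha : 0 < a) (haD : a * D < Real.pi) {s : ℝ}
    (hs : s ∈ Icc 0 D) : 0 ≤ gapProfileDeriv a (Real.cos (a * D / 2) ^ 3 / 2) s := by
  have h1 : 0 ≤ a * s / 2 := by have := hs.1; positivity
  have h2 : a * s / 2 ≤ a * D / 2 := by
    linarith [mul_le_mul_of_nonneg_left hs.2 ha.le]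
  have hc : Real.cos (a * D / 2) ≤ Real.cos (a * s / 2) :=
    Real.cos_le_cos_of_nonneg_of_le_pi h1 (by linarith [Real.pi_pos]) h2
  have hc0 : 0 < Real.cos (a * D / 2) := by
    apply Real.cos_pos_of_mem_Ioo
    constructor <;> linarith [Real.pi_pos]
  have hs0 : 0 ≤ Real.sin (a * s / 2) :=
    Real.sin_nonneg_of_nonneg_of_le_pi h1 (by linarith [Real.pi_pos])
  rw [gapProfileDeriv]
  set c := Real.cos (a * s / 2)
  set b := Real.cos (a * D / 2)
  set σ := Real.sin (a * s / 2)
  have hcp : 0 < c := hc0.trans_le hc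
  have hσ1 : σ ≤ 1 := Real.sin_le_one _
  have hc1 : c ≤ 1 := Real.cos_le_one _
  have hbc : b ^ 3 ≤ c ^ 3 := pow_le_pow_left₀ hc0.le hc 3
  have key : 2 * c - b ^ 3 / 2 * (2 * σ + σ / c ^ 2)
      = (2 * c ^ 3 - b ^ 3 / 2 * (σ * (2 * c ^ 2 + 1))) / c ^ 2 := by
    field_simp
  rw [key]
  have hσc : σ * (2 * c ^ 2 + 1) ≤ 3 := by
    have : c ^ 2 ≤ 1 := by nlinarith
    nlinarith
  have : b ^ 3 / 2 * (σ * (2 * c ^ 2 + 1)) ≤ b ^ 3 / 2 * 3 :=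
    mul_le_mul_of_nonneg_left hσc (by positivity)
  have : 0 < c ^ 3 := by positivity
  refine mul_nonneg (by positivity) (div_nonneg ?_ (by positivity))
  linarith

theorem le_gapProfile {a D : ℝ} (ha : 0 < a) (haD : a * D < Real.pi) {s : ℝ}
    (hs : s ∈ Icc 0 D) :
    Real.cos (a * D / 2) ^ 3 / 2 ≤ gapProfile a (Real.cos (a * D / 2) ^ 3 / 2) s := by
  have hcos : ∀ s ∈ Icc 0 D, Real.cos (a * s / 2) ≠ 0 := fun s hs => by
    have := mul_le_mul_of_nonneg_left hs.2 ha.le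
    have := mul_nonneg ha.le hs.1
    apply ne_of_gt
    apply Real.cos_pos_of_mem_Ioo
    constructor <;> linarith [Real.pi_pos]
  have hmono : MonotoneOn (gapProfile a (Real.cos (a * D / 2) ^ 3 / 2)) (Icc 0 D) :=
    monotoneOn_of_deriv_nonneg (convex_Icc 0 D)
      (fun s hs => (hasDerivAt_gapProfile (hcos s hs)).continuousAt.continuousWithinAt)
      (fun s hs => (hasDerivAt_gapProfile
        (hcos s (interior_subset hs))).differentiableAt.differentiableWithinAt)
      (fun s hs => by
        rw [(hasDerivAt_gapProfile (hcos s (interior_subset hs))).deriv]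
        exact gapProfileDeriv_nonneg ha haD (interior_subset hs))
  have := hmono ⟨le_rfl, hs.1.trans hs.2⟩ hs hs.1
  refine le_trans (le_of_eq ?_) this
  simp [gapProfile]
  ring

namespace IsLogGroundState

variable {Ω : Set (Euc n)} {v U : Euc n → ℝ} {M S : ℝ}

set_option maxHeartbeats 1000000 in
/-- The gap comparison: an eigenvalue of the drift Laplacian with a nonconstant bounded
eigenfunction is at least `3 a²`. -/
theorem three_mul_sq_le (h : IsLogGroundState Ω v U M S) {a D : ℝ} (ha : 0 < a)
    (haD : a * D < Real.pi) (hD : ∀ x ∈ Ω, ∀ y ∈ Ω, ‖y - x‖ ≤ D)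
    (hmod : ∀ x ∈ Ω, ∀ y ∈ Ω, x ≠ y → (fderiv ℝ v y (y - x) - fderiv ℝ v x (y - x)) / ‖y - x‖
      + 2 * a * Real.tan (a * ‖y - x‖ / 2) ≤ 0)
    {w : Euc n → ℝ} {μ B : ℝ} (hw : ∀ x ∈ Ω, ContDiffAt ℝ 2 w x)
    (heq : ∀ x ∈ Ω, lap w x + 2 * fderiv ℝ w x (gradient v x) = -(μ * w x))
    (hB : ∀ x ∈ Ω, |w x| ≤ B) {x₁ y₁ : Euc n} (hx₁ : x₁ ∈ Ω) (hy₁ : y₁ ∈ Ω)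
    (hlt₁ : w x₁ < w y₁) : 3 * a ^ 2 ≤ μ := by
  by_contra! hμ
  set κ := Real.cos (a * D / 2) ^ 3 / 2 with hκ
  have hD0 : 0 ≤ D := (norm_nonneg _).trans (hD x₁ hx₁ y₁ hy₁)
  have hκ0 : 0 < κ := by
    have : 0 < Real.cos (a * D / 2) := by
      apply Real.cos_pos_of_mem_Ioo
      have := mul_nonneg ha.le hD0
      constructor <;> linarith [Real.pi_pos]
    positivity
  set f := gapProfile a κ with hf
  have hfκ : ∀ x ∈ Ω, ∀ y ∈ Ω, κ ≤ f ‖y - x‖ := fun x hx y hy =>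
    le_gapProfile ha haD ⟨norm_nonneg _, hD x hx y hy⟩
  have hcos : ∀ x ∈ Ω, ∀ y ∈ Ω, Real.cos (a * ‖y - x‖ / 2) ≠ 0 := fun x hx y hy => by
    have := mul_le_mul_of_nonneg_left (hD x hx y hy) ha.le
    have := mul_nonneg ha.le (norm_nonneg (y - x))
    apply ne_of_gt
    apply Real.cos_pos_of_mem_Ioo
    constructor <;> linarith [Real.pi_pos]
  set A : Set ℝ := (fun p : Euc n × Euc n => (w p.2 - w p.1) / f ‖p.2 - p.1‖) '' (Ω ×ˢ Ω) with hA
  set C := sSup A with hC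
  have hAbdd : BddAbove A := by
    refine ⟨2 * B / κ, ?_⟩
    rintro _ ⟨p, hp, rfl⟩
    have h1 := abs_le.mp (hB p.1 hp.1)
    have h2 := abs_le.mp (hB p.2 hp.2)
    exact div_le_div₀ (by linarith) (by linarith) hκ0 (hfκ _ hp.1 _ hp.2)
  have hCle : ∀ x ∈ Ω, ∀ y ∈ Ω, w y - w x ≤ C * f ‖y - x‖ := fun x hx y hy => by
    rw [← div_le_iff₀ (hκ0.trans_le (hfκ x hx y hy))]
    exact le_csSup hAbdd ⟨(x, y), ⟨hx, hy⟩, rfl⟩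
  have hC0 : 0 < C := by
    have := hCle x₁ hx₁ y₁ hy₁
    exact pos_of_mul_pos_left (by linarith) (hκ0.trans_le (hfκ x₁ hx₁ y₁ hy₁)).le
  set μ' := max μ 0 with hμ'
  have hμ'0 : 0 ≤ μ' := le_max_right _ _
  have hμ'lt : μ' < 3 * a ^ 2 := max_lt hμ (by positivity)
  set C' := C * (3 * a ^ 2 + μ') / (6 * a ^ 2) with hC'
  have hC'0 : 0 < C' := by positivity
  have hC'eq : 3 * a ^ 2 * C' = C * (3 * a ^ 2 + μ') / 2 := by rw [hC']; field_simp; ring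
  have hC'lt : C' < C := by
    rw [hC', div_lt_iff₀ (by positivity)]
    nlinarith
  have hgain : 0 < 3 * a ^ 2 * C' - μ' * C := by
    rw [hC'eq]; nlinarith
  obtain ⟨_, ⟨⟨x₀, y₀⟩, ⟨hx₀, hy₀⟩, rfl⟩, hlt₀⟩ := exists_lt_of_lt_csSup
    (⟨_, ⟨(x₁, y₁), ⟨hx₁, hy₁⟩, rfl⟩⟩ : A.Nonempty) hC'lt
  simp only at hx₀ hy₀
  dsimp only at hlt₀
  rw [lt_div_iff₀ (hκ0.trans_le (hfκ x₀ hx₀ y₀ hy₀))] at hlt₀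
  set δ := w y₀ - w x₀ - C' * f ‖y₀ - x₀‖ with hδ
  have hδ0 : 0 < δ := by linarith
  obtain ⟨ε, hε0, hε1, hε2⟩ := exists_pos_mul_lt_and
    (show 0 < min δ (C' * κ) from lt_min hδ0 (by positivity))
    (show 0 < (3 * a ^ 2 * C' - μ' * C) * κ by positivity) (|v x₀ + v y₀| + 2 * |S|) (2 * M)
  obtain ⟨hε1, hε1'⟩ := lt_min_iff.mp hε1
  have hεv : -δ < ε * (v x₀ + v y₀) := by
    have h5 : ε * -|v x₀ + v y₀| ≤ ε * (v x₀ + v y₀) :=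
      mul_le_mul_of_nonneg_left (neg_abs_le _) hε0.le
    have : 0 ≤ ε * (2 * |S|) := by positivity
    linarith
  have hεS : ∀ x ∈ Ω, ∀ y ∈ Ω, ε * (v x + v y) < C' * κ := fun x hx y hy => by
    have h4 : ε * (v x + v y) ≤ ε * (2 * |S|) := mul_le_mul_of_nonneg_left
      (by linarith [h.le_upper x hx, h.le_upper y hy, le_abs_self S]) hε0.le
    have : 0 ≤ ε * |v x₀ + v y₀| := by positivity
    linarith
  have hwc : ContinuousOn w Ω := fun x hx => (hw x hx).continuousAt.continuousWithinAt
  set F : Euc n × Euc n → ℝ := fun p => w p.2 - w p.1 - C' * f ‖p.2 - p.1‖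
    + ε * (v p.1 + v p.2) with hF
  have hF0 : 0 < F (x₀, y₀) := by simp only [hF]; linarith
  obtain ⟨⟨x, y⟩, ⟨hx, hy⟩, hmax⟩ := exists_isMaxOn_of_boundary (h.isBounded.prod h.isBounded)
    (F := F) (by
      have i1 : MapsTo (fun p : Euc n × Euc n => p.1) (Ω ×ˢ Ω) Ω := fun p hp => hp.1
      have i2 : MapsTo (fun p : Euc n × Euc n => p.2) (Ω ×ˢ Ω) Ω := fun p hp => hp.2
      have cd : ContinuousOn (fun p : Euc n × Euc n => ‖p.2 - p.1‖) (Ω ×ˢ Ω) := by fun_prop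
      have c5 : ContinuousOn (fun p : Euc n × Euc n => f ‖p.2 - p.1‖) (Ω ×ˢ Ω) := fun p hp =>
        ContinuousAt.comp_continuousWithinAt (g := f)
          (hasDerivAt_gapProfile (hcos _ hp.1 _ hp.2)).continuousAt (cd p hp)
      exact (((hwc.comp continuousOn_snd i2).sub (hwc.comp continuousOn_fst i1)).sub
        (c5.const_smul C')).add (((h.continuousOn.comp continuousOn_fst i1).add
          (h.continuousOn.comp continuousOn_snd i2)).const_smul ε))
    (p₀ := (x₀, y₀)) ⟨hx₀, hy₀⟩ (by
      intro q hq hq'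
      filter_upwards [((h.tendsto_prod hq hq').const_mul_atBot hε0).eventually_lt_atBot (-(2 * B)),
        eventually_mem_nhdsWithin] with p h1 h2
      have g1 := abs_le.mp (hB p.1 h2.1)
      have g2 := abs_le.mp (hB p.2 h2.2)
      have g3 : 0 ≤ C' * f ‖p.2 - p.1‖ :=
        mul_nonneg hC'0.le (hκ0.le.trans (hfκ _ h2.1 _ h2.2))
      refine lt_trans ?_ hF0
      simp only [hF]
      linarith)
  simp only at hx hy
  have hFpos : 0 < F (x, y) := hF0.trans_le (hmax (x₀, y₀) ⟨hx₀, hy₀⟩)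
  have hgap : 0 < w y - w x := by
    have h1 := hεS x hx y hy
    have h2 := mul_le_mul_of_nonneg_left (hfκ x hx y hy) hC'0.le
    simp only [hF] at hFpos
    linarith
  have hxy : x ≠ y := by
    rintro rfl
    simp at hgap
  set r := ‖y - x‖ with hrdef
  have hr0 : 0 < r := norm_pos_iff.mpr (sub_ne_zero.mpr hxy.symm)
  obtain ⟨e, he, hre⟩ : ∃ e : Euc n, ‖e‖ = 1 ∧ y - x = r • e :=
    ⟨r⁻¹ • (y - x), by rw [norm_smul, ← hrdef, norm_inv, norm_norm]; exact inv_mul_cancel₀ hr0.ne',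
      by rw [smul_smul, mul_inv_cancel₀ hr0.ne', one_smul]⟩
  have hvx := h.contDiffAt_two hx
  have hvy := h.contDiffAt_two hy
  have hf1 := hasDerivAt_gapProfile (κ := κ) (hcos x hx y hy)
  have hf2 := hasDerivAt_gapProfileDeriv (κ := κ) (hcos x hx y hy)
  rw [← hrdef] at hf1 hf2
  have hf'0 : 0 ≤ gapProfileDeriv a κ r :=
    gapProfileDeriv_nonneg ha haD ⟨hr0.le, hD x hx y hy⟩
  set f' := gapProfileDeriv a κ r
  have hinner : ∀ η : Euc n, ⟪y - x, η⟫ / ‖y - x‖ = ⟪e, η⟫ := fun η => by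
    rw [← hrdef, hre, real_inner_smul_left]; field_simp
  have hfy : fderiv ℝ w y (gradient v y) - C' * (f' * ⟪e, gradient v y⟫)
      + ε * (0 + fderiv ℝ v y (gradient v y)) = 0 := by
    set η := gradient v y
    have hm : IsLocalMax (fun t : ℝ => w (y + t • η) - w x - C' * f ‖y - x + t • η‖
        + ε * (v x + v (y + t • η))) 0 := by
      filter_upwards [(tendsto_line_zero y η).eventually (h.isOpen.mem_nhds hy)] with t ht
      have := hmax (x, y + t • η) ⟨hx, ht⟩
      simp only [hF, show y + t • η - x = y - x + t • η by abel] at this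
      simpa using this
    have hN := hasDerivAt_norm_line (sub_ne_zero.mpr hxy.symm) η
    rw [hinner] at hN
    exact hm.hasDerivAt_eq_zero
      ((((hasDerivAt_comp_line_zero ((hw y hy).differentiableAt (by simp))).sub_const _).sub
        ((HasDerivAt.comp (h₂ := f) (0 : ℝ) (by simpa using hf1) hN).const_mul C')).add
        (((hasDerivAt_const _ _).add
          (hasDerivAt_comp_line_zero (hvy.differentiableAt (by simp)))).const_mul ε))
  have hfx : -fderiv ℝ w x (gradient v x) - C' * (f' * -⟪e, gradient v x⟫)
      + ε * (fderiv ℝ v x (gradient v x) + 0) = 0 := by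
    set η := gradient v x
    have hm : IsLocalMax (fun t : ℝ => w y - w (x + t • η) - C' * f ‖y - x + t • (-η)‖
        + ε * (v (x + t • η) + v y)) 0 := by
      filter_upwards [(tendsto_line_zero x η).eventually (h.isOpen.mem_nhds hx)] with t ht
      have := hmax (x + t • η, y) ⟨ht, hy⟩
      simp only [hF, show y - (x + t • η) = y - x + t • (-η) by rw [smul_neg]; abel] at this
      simpa using this
    have hN := hasDerivAt_norm_line (sub_ne_zero.mpr hxy.symm) (-η)
    rw [hinner, inner_neg_right] at hN
    exact hm.hasDerivAt_eq_zero
      ((((hasDerivAt_comp_line_zero ((hw x hx).differentiableAt (by simp))).const_sub _).sub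
        ((HasDerivAt.comp (h₂ := f) (0 : ℝ) (by simpa using hf1) hN).const_mul C')).add
        (((hasDerivAt_comp_line_zero (hvx.differentiableAt (by simp))).add
          (hasDerivAt_const _ _)).const_mul ε))
  have hlap := lap_sub_lap_le (f₁ := fun z => w z + ε * v z)
    (f₂ := fun z => w z + -ε * v z) (x := x) (y := y)
    ((hw y hy).add (contDiffAt_const.mul hvy)) ((hw x hx).add (contDiffAt_const.mul hvx)) he
    (Φ := fun s => C' * gapProfile a κ s) (Φ' := fun s => C' * gapProfileDeriv a κ s) (r := r)
    (by
      have g1 : ∀ᶠ s in 𝓝 r, Real.cos (a * s / 2) ≠ 0 := by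
        have : Continuous fun s : ℝ => Real.cos (a * s / 2) := by fun_prop
        exact this.continuousAt.eventually_ne (hcos x hx y hy)
      filter_upwards [g1] with s g1
      exact (hasDerivAt_gapProfile g1).const_mul C') (hf2.const_mul C')
    (fun η => by
      filter_upwards [eventually_reflected_motion h.isOpen hx hy he hr0 hre η]
        with t ⟨hx', hy', hr', he', hn'⟩
      have := hmax (_, _) ⟨hx', hy'⟩
      simp only [hF, hn', ← hrdef] at this
      simp only [zero_smul, add_zero, zero_mul]
      simp only [hf] at this
      linarith)
  rw [lap_add_smul (hw y hy) hvy, lap_add_smul (hw x hx) hvx] at hlap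
  have gy : fderiv ℝ v y (gradient v y) = ‖gradient v y‖ ^ 2 := by
    rw [← inner_gradient_left, real_inner_self_eq_norm_sq]
  have gx : fderiv ℝ v x (gradient v x) = ‖gradient v x‖ ^ 2 := by
    rw [← inner_gradient_left, real_inner_self_eq_norm_sq]
  have hk := hmod x hx y hy hxy
  rw [← hrdef, hre, map_smul, map_smul, smul_eq_mul, smul_eq_mul, ← mul_sub,
    mul_div_cancel_left₀ _ hr0.ne', ← inner_gradient_left, ← inner_gradient_left] at hk
  rw [real_inner_comm e, real_inner_comm e] at hk
  rw [gy] at hfy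
  rw [gx] at hfx
  have hk' := mul_le_mul_of_nonneg_left hk (mul_nonneg hC'0.le hf'0)
  have hMx' := mul_le_mul_of_nonneg_left (h.neg_le x hx) hε0.le
  have hMy' := mul_le_mul_of_nonneg_left (h.neg_le y hy) hε0.le
  rw [← h.lap_add x hx] at hMx'
  rw [← h.lap_add y hy] at hMy'
  have hpos : 0 ≤ ε * (‖gradient v y‖ ^ 2 + ‖gradient v x‖ ^ 2) := by positivity
  have eqx := heq x hx
  have eqy := heq y hy
  have hμw : μ * (w y - w x) ≤ μ' * C * f r := by
    calc μ * (w y - w x) ≤ μ' * (w y - w x) :=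
          mul_le_mul_of_nonneg_right (le_max_left _ _) hgap.le
      _ ≤ μ' * (C * f r) := mul_le_mul_of_nonneg_left (hCle x hx y hy) hμ'0
      _ = _ := by ring
  have hlast : 3 * a ^ 2 * C' * f r ≤ μ * (w y - w x) + 2 * (ε * M) := by
    have hfr : f r = gapProfile a κ r := rfl
    linarith only [hfr, hlap, hfy, hfx, hk', hMx', hMy', hpos, eqx, eqy]
  have hfin := mul_le_mul_of_nonneg_left (hfκ x hx y hy) hgain.le
  linarith

end IsLogGroundState

end GapComparison

theorem IsOpen.notMem_of_mem_frontier {X : Type*} [TopologicalSpace X] {Ω : Set X} (ho : IsOpen Ω)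
    {p : X} (hp : p ∈ frontier Ω) : p ∉ Ω := by
  rw [ho.frontier_eq] at hp; exact hp.2

theorem IsOpen.infDist_frontier_pos {X : Type*} [PseudoMetricSpace X] {Ω : Set X} (ho : IsOpen Ω)
    (hne : (frontier Ω).Nonempty) {x : X} (hx : x ∈ Ω) : 0 < infDist x (frontier Ω) :=
  (isClosed_frontier.notMem_iff_infDist_pos hne).1 fun h => ho.notMem_of_mem_frontier h hx

section BoundaryDistance

variable {E : Type*} [NormedAddCommGroup E] [InnerProductSpace ℝ E] {Ω : Set E}

theorem IsOpen.ball_infDist_frontier_subset (ho : IsOpen Ω) {x : E} (hx : x ∈ Ω) :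
    ball x (infDist x (frontier Ω)) ⊆ Ω := by
  rcases (infDist_nonneg (x := x) (s := frontier Ω)).eq_or_lt with h0 | h0
  · rw [← h0, ball_zero]; exact empty_subset _
  refine (convex_ball x _).isPreconnected.subset_left_of_subset_union ho
    isClosed_closure.isOpen_compl (v := (closure Ω)ᶜ)
    (disjoint_compl_right.mono_left subset_closure) ?_ ⟨x, mem_ball_self h0, hx⟩
  intro y hy
  by_cases h1 : y ∈ Ω
  · exact Or.inl h1
  right
  intro h2
  have : y ∈ frontier Ω := by rw [ho.frontier_eq]; exact ⟨h2, h1⟩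
  have h3 := infDist_le_dist_of_mem (x := x) this
  rw [mem_ball, dist_comm] at hy
  linarith

theorem Convex.half_add_infDist_frontier_le (hc : Convex ℝ Ω) (ho : IsOpen Ω)
    (hne : (frontier Ω).Nonempty) {x y : E} (hx : x ∈ Ω) (hy : y ∈ Ω) :
    (infDist x (frontier Ω) + infDist y (frontier Ω)) / 2 ≤
      infDist ((1 / 2 : ℝ) • (x + y)) (frontier Ω) := by
  have hdx := ho.infDist_frontier_pos hne hx
  have hdy := ho.infDist_frontier_pos hne hy
  have hbx := ho.ball_infDist_frontier_subset hx
  have hby := ho.ball_infDist_frontier_subset hy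
  set a := infDist x (frontier Ω)
  set b := infDist y (frontier Ω)
  refine (le_infDist hne).2 fun p hp => ?_
  by_contra! hlt
  refine ho.notMem_of_mem_frontier hp ?_
  set e := p - (1 / 2 : ℝ) • (x + y) with he
  have hen : ‖e‖ < (a + b) / 2 := by rw [he, ← dist_eq_norm, dist_comm]; exact hlt
  have key : ∀ c : ℝ, 0 < c → ‖(c / ((a + b) / 2)) • e‖ < c := fun c h0 => by
    rw [norm_smul, Real.norm_of_nonneg (by positivity), div_mul_eq_mul_div,
      div_lt_iff₀ (by positivity)]
    exact mul_lt_mul_of_pos_left hen h0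
  have h1 : x + (a / ((a + b) / 2)) • e ∈ Ω := hbx (by
    rw [mem_ball, dist_eq_norm, add_sub_cancel_left]; exact key a hdx)
  have h2 : y + (b / ((a + b) / 2)) • e ∈ Ω := hby (by
    rw [mem_ball, dist_eq_norm, add_sub_cancel_left]; exact key b hdy)
  have h3 := hc h1 h2 (a := 1 / 2) (b := 1 / 2) (by norm_num) (by norm_num) (by norm_num)
  convert h3 using 1
  have : p = (1 / 2 : ℝ) • (x + y) + e := by rw [he]; abel
  have hs : (1 / 2 : ℝ) * (a / ((a + b) / 2)) + (1 / 2 : ℝ) * (b / ((a + b) / 2)) = 1 := by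
    field_simp
  rw [smul_add, smul_add, smul_smul, smul_smul, add_add_add_comm, ← add_smul, hs, one_smul,
    ← smul_add]
  exact this

/-- The nearest boundary point `p` of `x` and the inner unit normal `ν` there. -/
theorem Convex.exists_nearest_frontier [ProperSpace E] (hc : Convex ℝ Ω) (ho : IsOpen Ω)
    (hne : (frontier Ω).Nonempty) {x : E} (hx : x ∈ Ω) :
    ∃ p ∈ frontier Ω, ∃ ν : E, ‖ν‖ = 1 ∧ x - p = infDist x (frontier Ω) • ν ∧
      (∀ y ∈ Ω, 0 ≤ ⟪y - p, ν⟫) ∧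
      (∀ t : ℝ, 0 < t → t ≤ 1 → p + t • (x - p) ∈ Ω ∧
        infDist (p + t • (x - p)) (frontier Ω) = t * infDist x (frontier Ω)) := by
  have hd := ho.infDist_frontier_pos hne hx
  have hb := ho.ball_infDist_frontier_subset hx
  obtain ⟨p, hp, hxp⟩ := isClosed_frontier.exists_infDist_eq_dist hne x
  set d := infDist x (frontier Ω) with hdd
  have hnp : ‖x - p‖ = d := by rw [← dist_eq_norm, hxp]
  have hpn := ho.notMem_of_mem_frontier hp
  have hν : x - p = d • (d⁻¹ • (x - p)) := by
    rw [smul_smul, mul_inv_cancel₀ hd.ne', one_smul]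
  refine ⟨p, hp, d⁻¹ • (x - p), ?_, hν, ?_, ?_⟩
  · rw [norm_smul, hnp, Real.norm_of_nonneg (by positivity), inv_mul_cancel₀ hd.ne']
  · intro y hy
    by_contra! hlt
    rw [inner_smul_right] at hlt
    have hlt' : ⟪y - p, x - p⟫ < 0 := by
      by_contra! h; exact absurd hlt (not_lt.2 (by positivity))
    -- the point `p - t (y - p)` lies in the ball around `x`
    obtain ⟨t, ht0, ht⟩ : ∃ t : ℝ, 0 < t ∧ t * ‖y - p‖ ^ 2 < -2 * ⟪y - p, x - p⟫ := by
      obtain ⟨t, h1, h2, -⟩ := exists_pos_mul_lt_and (b₁ := -2 * ⟪y - p, x - p⟫)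
        (by linarith) one_pos (‖y - p‖ ^ 2) 0
      exact ⟨t, h1, h2⟩
    have hm : p - t • (y - p) ∈ Ω := by
      refine hb ?_
      rw [mem_ball, dist_eq_norm]
      refine lt_of_pow_lt_pow_left₀ 2 hd.le ?_
      have e : p - t • (y - p) - x = -((x - p) + t • (y - p)) := by abel
      rw [e, norm_neg, norm_add_sq_real, hnp, norm_smul, Real.norm_of_nonneg ht0.le,
        inner_smul_right, real_inner_comm]
      nlinarith
    refine hpn ?_
    have := hc hm hy (a := 1 / (1 + t)) (b := t / (1 + t)) (by positivity) (by positivity)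
      (by field_simp)
    convert this using 1
    have h1 : p = (1 / (1 + t) + t / (1 + t)) • p := by
      rw [← add_div, div_self (by positivity), one_smul]
    conv_lhs => rw [h1]
    rw [smul_sub, smul_smul, smul_sub, add_smul, show 1 / (1 + t) * t = t / (1 + t) by ring]
    abel
  · intro t ht0 ht1
    have e1 : dist (p + t • (x - p)) x = (1 - t) * d := by
      rw [dist_eq_norm, show p + t • (x - p) - x = -((1 - t) • (x - p)) by
        rw [sub_smul, one_smul]; abel, norm_neg, norm_smul, hnp,
        Real.norm_of_nonneg (by linarith)]
    refine ⟨hb ?_, le_antisymm ?_ ?_⟩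
    · rw [mem_ball, e1]; nlinarith
    · refine (infDist_le_dist_of_mem hp).trans_eq ?_
      rw [dist_eq_norm, add_sub_cancel_left, norm_smul, hnp, Real.norm_of_nonneg ht0.le]
    · have := infDist_le_infDist_add_dist (s := frontier Ω) (x := x) (y := p + t • (x - p))
      rw [dist_comm, e1] at this
      linarith

/-- If `z` is the midpoint of a segment in `Ω`, the normal part of the segment is controlled by
the distance of `z` to the boundary. -/
theorem abs_inner_le_of_midpoint {x y z p ν : E} {d : ℝ} (hz : z = (1 / 2 : ℝ) • (x + y))
    (hν : ‖ν‖ = 1) (hzp : z - p = d • ν) (hx : 0 ≤ ⟪x - p, ν⟫) (hy : 0 ≤ ⟪y - p, ν⟫) :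
    |⟪y - x, ν⟫| ≤ 2 * d := by
  have h1 : ⟪z - p, ν⟫ = d := by rw [hzp, inner_smul_left, real_inner_self_eq_norm_sq, hν]; simp
  have h2 : ⟪x - p, ν⟫ + ⟪y - p, ν⟫ = 2 * ⟪z - p, ν⟫ := by
    subst hz
    simp only [inner_sub_left, inner_smul_left, inner_add_left]
    simp
    ring
  have h3 : ⟪y - x, ν⟫ = ⟪y - p, ν⟫ - ⟪x - p, ν⟫ := by
    simp only [inner_sub_left]; ring
  rw [h3, abs_le]
  constructor <;> linarith

end BoundaryDistance

section BoundaryRegularity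

theorem ContDiffOn.exists_norm_fderiv_le {E F : Type*} [NormedAddCommGroup E] [NormedSpace ℝ E]
    [NormedAddCommGroup F] [NormedSpace ℝ F] {f : E → F} {T K : Set E}
    (hf : ContDiffOn ℝ 2 f T) (hT : UniqueDiffOn ℝ T) (hK : IsCompact K) (hKT : K ⊆ T) :
    ∃ C : ℝ, 0 ≤ C ∧ ∀ x ∈ K, x ∈ interior T →
      ‖fderiv ℝ f x‖ ≤ C ∧ ‖fderiv ℝ (fderiv ℝ f) x‖ ≤ C := by
  have h1 : ContDiffOn ℝ 1 (fderivWithin ℝ f T) T := hf.fderivWithin hT (by norm_num)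
  have h2 : ContinuousOn (fderivWithin ℝ (fderivWithin ℝ f T) T) T :=
    h1.continuousOn_fderivWithin hT le_rfl
  obtain ⟨C₁, hC₁⟩ := hK.exists_bound_of_continuousOn (h1.continuousOn.mono hKT)
  obtain ⟨C₂, hC₂⟩ := hK.exists_bound_of_continuousOn
    (f := fderivWithin ℝ (fderivWithin ℝ f T) T) (h2.mono hKT)
  refine ⟨max 0 (max C₁ C₂), le_max_left _ _, fun x hx hxi => ?_⟩
  have hT' : T ∈ 𝓝 x := mem_interior_iff_mem_nhds.1 hxi
  have e : fderivWithin ℝ f T =ᶠ[𝓝 x] fderiv ℝ f := by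
    filter_upwards [isOpen_interior.mem_nhds hxi] with y hy
    exact fderivWithin_of_mem_nhds (mem_interior_iff_mem_nhds.1 hy)
  have h3 := hC₁ x hx
  have h4 := hC₂ x hx
  rw [e.self_of_nhds] at h3
  rw [fderivWithin_of_mem_nhds hT', e.fderiv_eq] at h4
  exact ⟨h3.trans ((le_max_left _ _).trans (le_max_right _ _)),
    h4.trans ((le_max_right _ _).trans (le_max_right _ _))⟩

variable {n : ℕ}

/-- A function on `Ω`, vanishing on the boundary, with bounded Lipschitz gradient. -/
structure IsDirichletRegular (Ω : Set (Euc n)) (φ : Euc n → ℝ) (G : ℝ) : Prop where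
  nonneg : 0 ≤ G
  continuousOn : ContinuousOn φ (closure Ω)
  contDiffAt : ∀ x ∈ Ω, ContDiffAt ℝ 3 φ x
  eq_zero : ∀ x ∈ frontier Ω, φ x = 0
  norm_fderiv_le : ∀ x ∈ Ω, ‖fderiv ℝ φ x‖ ≤ G
  norm_fderiv_sub_le : ∀ x ∈ Ω, ∀ y ∈ Ω, ‖fderiv ℝ φ y - fderiv ℝ φ x‖ ≤ G * ‖y - x‖

theorem exists_isDirichletRegular {Ω : Set (Euc n)} {φ : Euc n → ℝ} (ho : IsOpen Ω)
    (hne : Ω.Nonempty) (hb : Bornology.IsBounded Ω) (hc : Convex ℝ Ω)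
    (hφ : ContDiffOn ℝ (⊤ : ℕ∞) φ (closure Ω)) (h0 : ∀ x ∈ frontier Ω, φ x = 0) :
    ∃ G, IsDirichletRegular Ω φ G := by
  have hsub : Ω ⊆ interior (closure Ω) := ho.subset_interior_closure
  have hsm : ∀ x ∈ Ω, ContDiffAt ℝ 3 φ x := fun x hx =>
    (hφ.contDiffAt (mem_interior_iff_mem_nhds.1 (hsub hx))).of_le
      (WithTop.coe_le_coe.2 (le_top : (3 : ℕ∞) ≤ ⊤))
  obtain ⟨C, hC0, hC⟩ := ContDiffOn.exists_norm_fderiv_le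
    (hφ.of_le (WithTop.coe_le_coe.2 (le_top : (2 : ℕ∞) ≤ ⊤)))
    (uniqueDiffOn_convex hc.closure (hne.mono hsub)) hb.isCompact_closure subset_rfl
  refine ⟨C, hC0, hφ.continuousOn, hsm, h0,
    fun x hx => (hC x (subset_closure hx) (hsub hx)).1, fun x hx y hy => ?_⟩
  refine hc.norm_image_sub_le_of_norm_fderiv_le (𝕜 := ℝ) (f := fderiv ℝ φ) (fun z hz => ?_)
    (fun z hz => (hC z (subset_closure hz) (hsub hz)).2) hx hy
  exact ((hsm z hz).fderiv_right (m := 1) (by norm_num)).differentiableAt (by simp)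

namespace IsDirichletRegular

variable {Ω : Set (Euc n)} {φ : Euc n → ℝ} {G : ℝ}

theorem differentiableAt (h : IsDirichletRegular Ω φ G) {x : Euc n} (hx : x ∈ Ω) :
    DifferentiableAt ℝ φ x := (h.contDiffAt x hx).differentiableAt (by simp)

theorem norm_gradient_le (h : IsDirichletRegular Ω φ G) {x : Euc n} (hx : x ∈ Ω) :
    ‖gradient φ x‖ ≤ G := by
  rw [gradient, LinearIsometryEquiv.norm_map]; exact h.norm_fderiv_le x hx

theorem norm_gradient_sub_le (h : IsDirichletRegular Ω φ G) {x y : Euc n} (hx : x ∈ Ω)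
    (hy : y ∈ Ω) : ‖gradient φ y - gradient φ x‖ ≤ G * ‖y - x‖ := by
  rw [gradient, gradient, ← map_sub, LinearIsometryEquiv.norm_map]
  exact h.norm_fderiv_sub_le x hx y hy

theorem abs_sub_le (h : IsDirichletRegular Ω φ G) (hc : Convex ℝ Ω) {x y : Euc n}
    (hx : x ∈ Ω) (hy : y ∈ closure Ω) : |φ y - φ x| ≤ G * ‖y - x‖ := by
  refine ContinuousWithinAt.closure_le (s := Ω) (f := fun y => |φ y - φ x|)
    (g := fun y => G * ‖y - x‖) hy ?_ ?_ fun z hz => ?_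
  · exact (((h.continuousOn y hy).mono subset_closure).sub continuousWithinAt_const).abs
  · exact Continuous.continuousWithinAt (by fun_prop)
  · exact hc.norm_image_sub_le_of_norm_fderiv_le (𝕜 := ℝ) (fun w hw => h.differentiableAt hw)
      h.norm_fderiv_le hx hz

theorem taylor (h : IsDirichletRegular Ω φ G) (hc : Convex ℝ Ω) {x y : Euc n} (hx : x ∈ Ω)
    (hy : y ∈ closure Ω) : |φ y - φ x - ⟪gradient φ x, y - x⟫| ≤ G * ‖y - x‖ ^ 2 := by
  refine ContinuousWithinAt.closure_le (s := Ω)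
    (f := fun y => |φ y - φ x - ⟪gradient φ x, y - x⟫|)
    (g := fun y => G * ‖y - x‖ ^ 2) hy ?_ ?_ fun z hz => ?_
  · exact ((((h.continuousOn y hy).mono subset_closure).sub continuousWithinAt_const).sub
      (Continuous.continuousWithinAt (by fun_prop))).abs
  · exact Continuous.continuousWithinAt (by fun_prop)
  · rw [inner_gradient_left, pow_two, ← mul_assoc]
    have hs := hc.segment_subset hx hz
    refine (convex_segment x z).norm_image_sub_le_of_norm_fderiv_le' (𝕜 := ℝ)
      (fun w hw => h.differentiableAt (hs hw)) (fun w hw => ?_)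
      (left_mem_segment ℝ x z) (right_mem_segment ℝ x z)
    refine (h.norm_fderiv_sub_le x hx w (hs hw)).trans (mul_le_mul_of_nonneg_left ?_ h.nonneg)
    obtain ⟨t, ⟨ht0, ht1⟩, rfl⟩ := segment_eq_image' ℝ x z ▸ hw
    simp only [add_sub_cancel_left]
    rw [norm_smul, Real.norm_of_nonneg ht0]
    exact mul_le_of_le_one_left (norm_nonneg _) ht1

theorem abs_le_mul_infDist (h : IsDirichletRegular Ω φ G) (hc : Convex ℝ Ω)
    (hne : (frontier Ω).Nonempty) {x : Euc n} (hx : x ∈ Ω) :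
    |φ x| ≤ G * infDist x (frontier Ω) := by
  obtain ⟨p, hp, hxp⟩ := isClosed_frontier.exists_infDist_eq_dist hne x
  have := h.abs_sub_le hc hx (frontier_subset_closure hp)
  rwa [h.eq_zero p hp, zero_sub, abs_neg, ← dist_eq_norm, dist_comm, ← hxp] at this

/-- First-order description of a nonnegative function near the boundary. -/
theorem near_boundary (h : IsDirichletRegular Ω φ G) (hc : Convex ℝ Ω) (ho : IsOpen Ω)
    (hpos : ∀ x ∈ Ω, 0 < φ x) {x p ν : Euc n} (hx : x ∈ Ω) (hp : p ∈ frontier Ω)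
    (hν : ‖ν‖ = 1) (hxp : x - p = infDist x (frontier Ω) • ν) :
    φ x ≤ infDist x (frontier Ω) * ⟪gradient φ x, ν⟫ + G * infDist x (frontier Ω) ^ 2 ∧
    infDist x (frontier Ω) * ‖gradient φ x‖ ≤ φ x + G * infDist x (frontier Ω) ^ 2 := by
  have hd := ho.infDist_frontier_pos ⟨p, hp⟩ hx
  have hb := ho.ball_infDist_frontier_subset hx
  set d := infDist x (frontier Ω)
  have hpx : p - x = -(d • ν) := by rw [← hxp]; abel
  constructor
  · have := h.taylor hc hx (frontier_subset_closure hp)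
    rw [h.eq_zero p hp, hpx, inner_neg_right, inner_smul_right, norm_neg, norm_smul, hν,
      Real.norm_of_nonneg hd.le, mul_one] at this
    linarith [(abs_le.1 this).1]
  · rcases eq_or_ne (gradient φ x) 0 with hX | hX
    · rw [hX, norm_zero, mul_zero]
      have := hpos x hx
      have := h.nonneg
      positivity
    have hXn : 0 < ‖gradient φ x‖ := norm_pos_iff.2 hX
    set y := x - (d / ‖gradient φ x‖) • gradient φ x with hy
    have hyx : y - x = -((d / ‖gradient φ x‖) • gradient φ x) := by rw [hy]; abel
    have hn : ‖y - x‖ = d := by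
      rw [hyx, norm_neg, norm_smul, Real.norm_of_nonneg (by positivity),
        div_mul_cancel₀ _ hXn.ne']
    have hyc : y ∈ closure Ω := by
      refine closure_mono hb ?_
      rw [closure_ball _ hd.ne', mem_closedBall, dist_eq_norm, hn]
    have hφy : 0 ≤ φ y := by
      by_cases hyΩ : y ∈ Ω
      · exact (hpos y hyΩ).le
      · exact (h.eq_zero y (by rw [ho.frontier_eq]; exact ⟨hyc, hyΩ⟩)).ge
    have := h.taylor hc hx hyc
    rw [hn, hyx, inner_neg_right, inner_smul_right, real_inner_self_eq_norm_sq,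
      show d / ‖gradient φ x‖ * ‖gradient φ x‖ ^ 2 = d * ‖gradient φ x‖ by field_simp] at this
    linarith [(abs_le.1 this).2]

/-- The tangential part of the gradient is of the order of the distance to the boundary. -/
theorem norm_tangential_le (h : IsDirichletRegular Ω φ G) (hc : Convex ℝ Ω) (ho : IsOpen Ω)
    (hpos : ∀ x ∈ Ω, 0 < φ x) {x p ν : Euc n} (hx : x ∈ Ω) (hp : p ∈ frontier Ω)
    (hν : ‖ν‖ = 1) (hxp : x - p = infDist x (frontier Ω) • ν)
    (hray : ∀ t : ℝ, 0 < t → t ≤ 1 → p + t • (x - p) ∈ Ω ∧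
        infDist (p + t • (x - p)) (frontier Ω) = t * infDist x (frontier Ω)) :
    ‖gradient φ x - ⟪gradient φ x, ν⟫ • ν‖ ≤ G * infDist x (frontier Ω) := by
  have hd := ho.infDist_frontier_pos ⟨p, hp⟩ hx
  set d := infDist x (frontier Ω)
  have hG := h.nonneg
  have hpyth : ∀ X : Euc n, ‖X - ⟪X, ν⟫ • ν‖ ^ 2 = ‖X‖ ^ 2 - ⟪X, ν⟫ ^ 2 := fun X => by
    rw [norm_sub_sq_real, norm_smul, hν, inner_smul_right, mul_one, Real.norm_eq_abs, sq_abs]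
    ring
  have hin : ∀ X : Euc n, ⟪X, ν⟫ ≤ ‖X‖ := fun X => by
    simpa [hν] using real_inner_le_norm X ν
  have hproj : ∀ X : Euc n, ‖X - ⟪X, ν⟫ • ν‖ ≤ ‖X‖ := fun X =>
    le_of_sq_le_sq (by rw [hpyth]; nlinarith [sq_nonneg ⟪X, ν⟫]) (norm_nonneg _)
  have key : ∀ t : ℝ, 0 < t → t ≤ 1 →
      ‖gradient φ x - ⟪gradient φ x, ν⟫ • ν‖ ≤ √(4 * G ^ 2 * (t * d)) + G * d := by
    intro t ht0 ht1
    obtain ⟨hz, hdz⟩ := hray t ht0 ht1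
    set z := p + t • (x - p) with hzdef
    have hzp : z - p = infDist z (frontier Ω) • ν := by
      rw [hdz, hzdef, add_sub_cancel_left, hxp, smul_smul]
    obtain ⟨h1, h2⟩ := h.near_boundary hc ho hpos hz hp hν hzp
    rw [hdz] at h1 h2
    have htd : 0 < t * d := mul_pos ht0 hd
    have h3 : ‖gradient φ z‖ - ⟪gradient φ z, ν⟫ ≤ 2 * G * (t * d) := by
      refine le_of_mul_le_mul_left ?_ htd
      nlinarith
    have h4 := h.norm_gradient_le hz
    have h5 : ‖gradient φ z - ⟪gradient φ z, ν⟫ • ν‖ ≤ √(4 * G ^ 2 * (t * d)) := by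
      refine Real.le_sqrt_of_sq_le ?_
      rw [hpyth]
      nlinarith [hin (gradient φ z), norm_nonneg (gradient φ z),
        mul_nonneg hG htd.le, mul_le_mul h3 (show ‖gradient φ z‖ + ‖gradient φ z‖ ≤ 2 * G by
          linarith) (by positivity) (by positivity),
        mul_nonneg (sub_nonneg.2 (hin (gradient φ z))) (sub_nonneg.2 (hin (gradient φ z)))]
    have hxz : ‖x - z‖ ≤ d := by
      rw [hzdef, show x - (p + t • (x - p)) = (1 - t) • (x - p) by
        rw [sub_smul, one_smul]; abel, norm_smul, hxp, norm_smul, hν, mul_one,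
        Real.norm_of_nonneg (by linarith), Real.norm_of_nonneg hd.le]
      nlinarith
    have h6 := h.norm_gradient_sub_le hz hx
    have h7 : gradient φ x - ⟪gradient φ x, ν⟫ • ν =
        (gradient φ z - ⟪gradient φ z, ν⟫ • ν) + ((gradient φ x - gradient φ z) -
          ⟪gradient φ x - gradient φ z, ν⟫ • ν) := by
      rw [inner_sub_left, sub_smul]; abel
    rw [h7]
    refine (norm_add_le _ _).trans (add_le_add h5 ((hproj _).trans (h6.trans ?_)))
    exact mul_le_mul_of_nonneg_left hxz hG
  have hlim : Tendsto (fun t : ℝ => √(4 * G ^ 2 * (t * d)) + G * d) (𝓝[>] 0) (𝓝 (G * d)) := by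
    have : Continuous fun t : ℝ => √(4 * G ^ 2 * (t * d)) + G * d := by fun_prop
    simpa using (this.tendsto 0).mono_left nhdsWithin_le_nhds
  refine ge_of_tendsto hlim ?_
  filter_upwards [Ioc_mem_nhdsGT (zero_lt_one' ℝ)] with t ht
  exact key t ht.1 ht.2

end IsDirichletRegular

end BoundaryRegularity

section Hopf

variable {n : ℕ}

theorem lap_nonneg_of_isLocalMin {f : Euc n → ℝ} {x : Euc n} (hf : ContDiffAt ℝ 2 f x)
    (hmin : IsLocalMin f x) : 0 ≤ lap f x := by
  refine Finset.sum_nonneg fun i _ => ?_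
  set e : Euc n := EuclideanSpace.single i 1
  have hd := (hf.fderiv_apply (m := 1) (by norm_num) e).differentiableAt (by simp)
  have h1 : IsLocalMax (fun t : ℝ => -f (x + t • e)) 0 := by
    have := (tendsto_line_zero x e).eventually hmin
    filter_upwards [this] with t ht
    simpa using ht
  have := IsLocalMax.second_deriv_nonpos h1
    ((hf.eventually_hasDerivAt_comp_line e).mono fun t ht => ht.neg)
    (hasDerivAt_comp_line_zero (η := e) hd).neg
  linarith

theorem neg_le_lap_of_norm_le {f : Euc n → ℝ} {x : Euc n} {C : ℝ} (hf : ContDiffAt ℝ 2 f x)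
    (hC : ‖fderiv ℝ (fderiv ℝ f) x‖ ≤ C) : -(n * C) ≤ lap f x := by
  have : ∑ _i : Fin n, -C ≤ lap f x := by
    refine Finset.sum_le_sum fun i _ => ?_
    rw [hf.fderiv_fderiv_apply]
    have h1 := (fderiv ℝ (fderiv ℝ f) x).le_opNorm₂ (EuclideanSpace.single i 1)
      (EuclideanSpace.single i 1)
    rw [PiLp.norm_single, norm_one, mul_one, mul_one, Real.norm_eq_abs] at h1
    linarith [(abs_le.1 (h1.trans hC)).1]
  simpa using this

theorem IsOpen.one_le_norm_gradient_infDist_frontier {Ω : Set (Euc n)} (ho : IsOpen Ω)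
    (hc : Convex ℝ Ω) (hne : (frontier Ω).Nonempty) {x : Euc n} (hx : x ∈ Ω)
    (hd : DifferentiableAt ℝ (fun y => infDist y (frontier Ω)) x) :
    1 ≤ ‖gradient (fun y => infDist y (frontier Ω)) x‖ := by
  obtain ⟨p, hp, ν, hν, hxp, -, hray⟩ := hc.exists_nearest_frontier ho hne hx
  have hpos := ho.infDist_frontier_pos hne hx
  set d := infDist x (frontier Ω) with hdd
  have h1 : HasDerivWithinAt (fun t : ℝ => (1 - t) * d)
      (fderiv ℝ (fun y => infDist y (frontier Ω)) x (p - x)) (Ici 0) 0 := by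
    refine (hasDerivAt_comp_line_zero (η := p - x) hd).hasDerivWithinAt.congr_of_eventuallyEq
      ?_ (by simp [hdd])
    filter_upwards [Ico_mem_nhdsGE (zero_lt_one' ℝ)] with t ht
    rw [← (hray (1 - t) (by linarith [ht.2]) (by linarith [ht.1])).2]
    congr 1
    rw [sub_smul, one_smul, ← neg_sub x p, smul_neg]
    abel
  have h2 : HasDerivWithinAt (fun t : ℝ => (1 - t) * d) (-d) (Ici 0) 0 := by
    have := (((hasDerivAt_id (0 : ℝ)).const_sub 1).mul_const d).hasDerivWithinAt (s := Ici 0)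
    simpa using this
  have h3 := (uniqueDiffWithinAt_Ici (0 : ℝ)).eq_deriv _ h1 h2
  rw [← inner_gradient_left, ← neg_sub x p, hxp, inner_neg_right, inner_smul_right] at h3
  have h4 : ⟪gradient (fun y => infDist y (frontier Ω)) x, ν⟫ = 1 := by
    have : d * ⟪gradient (fun y => infDist y (frontier Ω)) x, ν⟫ = d * 1 := by linarith
    exact mul_left_cancel₀ hpos.ne' this
  have h5 := real_inner_le_norm (gradient (fun y => infDist y (frontier Ω)) x) ν
  rwa [h4, hν, mul_one] at h5

/-- Hopf's lemma: positive solutions grow at least linearly away from the boundary. -/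
theorem exists_pos_mul_infDist_le {Ω : Set (Euc n)} (ho : IsOpen Ω) (hc : Convex ℝ Ω)
    (hne : (frontier Ω).Nonempty) (hΩ : Ω.Nonempty) (hb : Bornology.IsBounded Ω)
    {φ : Euc n → ℝ} {M r₀ : ℝ} (hr₀ : 0 < r₀)
    (hd : ContDiffOn ℝ 2 (fun x => infDist x (frontier Ω))
      {x ∈ closure Ω | infDist x (frontier Ω) ≤ r₀})
    (hcont : ContinuousOn φ (closure Ω)) (hφ : ∀ x ∈ Ω, ContDiffAt ℝ 2 φ x)
    (hpos : ∀ x ∈ Ω, 0 < φ x) (h0 : ∀ x ∈ frontier Ω, φ x = 0)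
    (hM : 0 ≤ M) (hlap : ∀ x ∈ Ω, lap φ x ≤ M * φ x) :
    ∃ c > 0, ∀ x ∈ Ω, c * infDist x (frontier Ω) ≤ φ x := by
  set δ : Euc n → ℝ := fun x => infDist x (frontier Ω) with hδ
  have hδc : Continuous δ := continuous_infDist_pt _
  have hδpos : ∀ x ∈ Ω, 0 < δ x := fun x hx => ho.infDist_frontier_pos hne hx
  have hδ0 : ∀ x ∈ frontier Ω, δ x = 0 := fun x hx => infDist_zero_of_mem hx
  have hKc := hb.isCompact_closure
  have hmem : ∀ x ∈ closure Ω, 0 < δ x → x ∈ Ω := fun x hx h => by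
    by_contra hxn
    exact h.ne' (hδ0 x (by rw [ho.frontier_eq]; exact ⟨hx, hxn⟩))
  -- second derivatives of the distance in a collar
  set T : Set (Euc n) := closure Ω ∩ {x | δ x < r₀} with hT
  have hTo : IsOpen {x | δ x < r₀} := isOpen_lt hδc continuous_const
  have hTu : UniqueDiffOn ℝ T :=
    (uniqueDiffOn_convex hc.closure (hΩ.mono ho.subset_interior_closure)).inter hTo
  have hdT : ContDiffOn ℝ 2 δ T := hd.mono fun x hx => ⟨hx.1, hx.2.le⟩
  obtain ⟨C, hC0, hC⟩ := ContDiffOn.exists_norm_fderiv_le hdT hTu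
    (K := closure Ω ∩ {x | δ x ≤ r₀ / 2})
    (hKc.inter_right (isClosed_le hδc continuous_const))
    (fun x hx => ⟨hx.1, (show δ x ≤ r₀ / 2 from hx.2).trans_lt (by linarith)⟩)
  have hTn : ∀ x ∈ Ω, δ x ≤ r₀ / 2 → T ∈ 𝓝 x := fun x hx h =>
    inter_mem (mem_of_superset (ho.mem_nhds hx) subset_closure)
      (hTo.mem_nhds (lt_of_le_of_lt h (by linarith)))
  set C' : ℝ := n * C
  have hC'0 : 0 ≤ C' := by positivity
  have hδC2 : ∀ x ∈ Ω, δ x ≤ r₀ / 2 → ContDiffAt ℝ 2 δ x := fun x hx h =>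
    hdT.contDiffAt (hTn x hx h)
  have hδlap : ∀ x ∈ Ω, δ x ≤ r₀ / 2 → -C' ≤ lap δ x := fun x hx h =>
    neg_le_lap_of_norm_le (hδC2 x hx h)
      (hC x ⟨subset_closure hx, h⟩ (mem_interior_iff_mem_nhds.2 (hTn x hx h))).2
  -- the barrier
  set K : ℝ := 2 * C' + 1 with hK
  have hK0 : 0 < K := by positivity
  set β : Euc n → ℝ := fun x => δ x + K * (δ x * δ x) with hβ
  obtain ⟨r₁', hr₁', h1, h2⟩ := exists_pos_mul_lt_and (half_pos one_pos) (half_pos one_pos) K M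
  set r₁ := min r₁' (r₀ / 2)
  have hr₁ : 0 < r₁ := lt_min hr₁' (by linarith)
  have hr₁K : r₁ * K ≤ 1 / 2 := (mul_le_mul_of_nonneg_right (min_le_left _ _) hK0.le).trans h1.le
  have hr₁M : r₁ * M ≤ 1 / 2 := (mul_le_mul_of_nonneg_right (min_le_left _ _) hM).trans h2.le
  have hβC2 : ∀ x ∈ Ω, δ x ≤ r₁ → ContDiffAt ℝ 2 β x := fun x hx h => by
    have := hδC2 x hx (h.trans (min_le_right _ _))
    exact this.add (contDiffAt_const.mul (this.mul this))
  have hβle : ∀ x ∈ Ω, δ x ≤ r₁ → M * β x ≤ 3 / 4 := fun x hx h => by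
    have hp := hδpos x hx
    have : β x ≤ r₁ * (3 / 2) := by
      have : K * δ x ≤ 1 / 2 := by nlinarith
      simp only [hβ]
      nlinarith
    nlinarith
  have hβlap : ∀ x ∈ Ω, δ x ≤ r₁ → 2 ≤ lap β x := fun x hx h => by
    have hp := hδpos x hx
    have hs := hδC2 x hx (h.trans (min_le_right _ _))
    have hg := ho.one_le_norm_gradient_infDist_frontier hc hne hx (hs.differentiableAt (by simp))
    have hl := hδlap x hx (h.trans (min_le_right _ _))
    have h3 : lap β x = lap δ x + K * lap (fun y => δ y * δ y) x :=
      lap_add_smul hs (hs.mul hs) K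
    rw [h3, lap_mul hs hs, real_inner_self_eq_norm_sq]
    have hg2 : 1 ≤ ‖gradient δ x‖ ^ 2 := one_le_pow₀ hg
    have : K * δ x ≤ 1 / 2 := by nlinarith
    have e : 0 ≤ (1 + 2 * (K * δ x)) * (lap δ x + C') := by
      apply mul_nonneg <;> nlinarith
    have e2 : C' * (K * δ x) ≤ C' * (1 / 2) := mul_le_mul_of_nonneg_left this hC'0
    have e3 : K * 1 ≤ K * ‖gradient δ x‖ ^ 2 := mul_le_mul_of_nonneg_left hg2 hK0.le
    nlinarith
  -- lower bound away from the boundary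
  obtain ⟨m, hm0, hm⟩ : ∃ m > 0, ∀ x ∈ closure Ω, r₁ ≤ δ x → m ≤ φ x := by
    rcases (closure Ω ∩ {x | r₁ ≤ δ x}).eq_empty_or_nonempty with he | he
    · exact ⟨1, one_pos, fun x hx h => absurd (show x ∈ closure Ω ∩ {x | r₁ ≤ δ x} from ⟨hx, h⟩)
        (by rw [he]; exact notMem_empty x)⟩
    · obtain ⟨x, hx, hxm⟩ := (hKc.inter_right (isClosed_le continuous_const hδc)).exists_isMinOn he
        (hcont.mono inter_subset_left)
      exact ⟨φ x, hpos x (hmem x hx.1 (hr₁.trans_le hx.2)), fun y hy h => hxm ⟨hy, h⟩⟩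
  obtain ⟨R, hR0, hR⟩ : ∃ R > 0, ∀ x ∈ closure Ω, δ x ≤ R := by
    obtain ⟨R, hR⟩ := hKc.exists_bound_of_continuousOn hδc.continuousOn
    exact ⟨max R 1, by positivity, fun x hx =>
      (le_abs_self _).trans ((hR x hx).trans (le_max_left _ _))⟩
  set ε : ℝ := m / (r₁ * (3 / 2)) with hε
  have hε0 : 0 < ε := by positivity
  have hcollar : ∀ x ∈ Ω, δ x ≤ r₁ → ε * β x ≤ φ x := by
    intro x hx hxr
    have hβc : Continuous β := by fun_prop
    obtain ⟨y, hy, hymin⟩ := (hKc.inter_right (isClosed_le hδc continuous_const)).exists_isMinOn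
      (s := closure Ω ∩ {x | δ x ≤ r₁}) ⟨x, subset_closure hx, hxr⟩
      (f := fun y => φ y + (-ε) * β y)
      ((hcont.mono inter_subset_left).add (by fun_prop))
    have hyx : φ y + (-ε) * β y ≤ φ x + (-ε) * β x := hymin ⟨subset_closure hx, hxr⟩
    suffices 0 ≤ φ y + (-ε) * β y by linarith
    by_contra! hneg
    have hyr : δ y ≤ r₁ := hy.2
    have hyΩ : y ∈ Ω := by
      by_contra hyn
      have hyf : y ∈ frontier Ω := by rw [ho.frontier_eq]; exact ⟨hy.1, hyn⟩
      simp [hβ, hδ0 y hyf, h0 y hyf] at hneg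
    have hβy : β y ≤ r₁ * (3 / 2) := by
      have hp := hδpos y hyΩ
      have : K * δ y ≤ 1 / 2 := by nlinarith
      simp only [hβ]
      nlinarith
    rcases hyr.eq_or_lt with hyr' | hyr'
    · have h3 := hm y hy.1 hyr'.ge
      have h4 : ε * β y ≤ m := by
        rw [hε, div_mul_eq_mul_div, div_le_iff₀ (by positivity)]
        exact mul_le_mul_of_nonneg_left hβy hm0.le
      linarith
    · have hloc : IsLocalMin (fun y => φ y + (-ε) * β y) y := by
        refine hymin.isLocalMin (inter_mem (mem_of_superset (ho.mem_nhds hyΩ) subset_closure) ?_)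
        exact mem_of_superset ((isOpen_lt hδc continuous_const).mem_nhds hyr')
          fun z (hz : δ z < r₁) => hz.le
      have h3 := lap_nonneg_of_isLocalMin
        ((hφ y hyΩ).add (contDiffAt_const.mul (hβC2 y hyΩ hyr))) hloc
      rw [lap_add_smul (hφ y hyΩ) (hβC2 y hyΩ hyr)] at h3
      have h4 := hlap y hyΩ
      have h5 := hβlap y hyΩ hyr
      have h6 := hβle y hyΩ hyr
      have h7 : M * φ y ≤ M * (ε * β y) := mul_le_mul_of_nonneg_left (by linarith) hM
      nlinarith
  refine ⟨min ε (m / R), lt_min hε0 (by positivity), fun x hx => ?_⟩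
  have hp := hδpos x hx
  rcases le_total (δ x) r₁ with h | h
  · refine le_trans ?_ (hcollar x hx h)
    exact mul_le_mul (min_le_left _ _) (by simp only [hβ]; nlinarith [mul_pos hp hp]) hp.le hε0.le
  · refine le_trans ?_ (hm x (subset_closure hx) h)
    calc min ε (m / R) * δ x ≤ m / R * R :=
          mul_le_mul (min_le_right _ _) (hR x (subset_closure hx)) hp.le (by positivity)
      _ = m := div_mul_cancel₀ _ hR0.ne'

end Hopf

section GroundState

variable {n : ℕ}

theorem gradient_log {f : Euc n → ℝ} {x : Euc n} (hf : DifferentiableAt ℝ f x) (hx : f x ≠ 0) :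
    gradient (fun y => Real.log (f y)) x = (f x)⁻¹ • gradient f x := by
  rw [gradient, gradient, (hf.hasFDerivAt.log hx).fderiv, map_smulₛₗ]
  simp

theorem lap_congr {f g : Euc n → ℝ} {x : Euc n} (h : f =ᶠ[𝓝 x] g) : lap f x = lap g x := by
  refine Finset.sum_congr rfl fun i _ => ?_
  have : (fun y => fderiv ℝ f y (EuclideanSpace.single i 1)) =ᶠ[𝓝 x]
      fun y => fderiv ℝ g y (EuclideanSpace.single i 1) := by
    filter_upwards [h.fderiv (𝕜 := ℝ)] with y hy
    rw [hy]
  rw [this.fderiv_eq]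

theorem Convex.log_infDist_frontier_add_le {E : Type*} [NormedAddCommGroup E]
    [InnerProductSpace ℝ E] {Ω : Set E} (hc : Convex ℝ Ω) (ho : IsOpen Ω)
    (hne : (frontier Ω).Nonempty) {x y : E} (hx : x ∈ Ω) (hy : y ∈ Ω) :
    Real.log (infDist x (frontier Ω)) + Real.log (infDist y (frontier Ω)) ≤
      2 * Real.log (infDist ((1 / 2 : ℝ) • (x + y)) (frontier Ω)) := by
  have hdx := ho.infDist_frontier_pos hne hx
  have hdy := ho.infDist_frontier_pos hne hy
  have h := hc.half_add_infDist_frontier_le ho hne hx hy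
  have e : 2 * Real.log (infDist ((1 / 2 : ℝ) • (x + y)) (frontier Ω)) =
      Real.log (infDist ((1 / 2 : ℝ) • (x + y)) (frontier Ω) ^ 2) := by
    rw [Real.log_pow]; norm_num
  rw [← Real.log_mul hdx.ne' hdy.ne', e]
  refine Real.log_le_log (mul_pos hdx hdy) ?_
  nlinarith [sq_nonneg (infDist x (frontier Ω) - infDist y (frontier Ω))]

namespace IsDirichletRegular

variable {Ω : Set (Euc n)} {φ : Euc n → ℝ} {G c : ℝ}

theorem log_midpoint_le (h : IsDirichletRegular Ω φ G) (hc : Convex ℝ Ω) (ho : IsOpen Ω)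
    (hne : (frontier Ω).Nonempty) (hpos : ∀ x ∈ Ω, 0 < φ x) (hc0 : 0 < c)
    (hopf : ∀ x ∈ Ω, c * infDist x (frontier Ω) ≤ φ x) {x y : Euc n} (hx : x ∈ Ω) (hy : y ∈ Ω) :
    Real.log (φ x) + Real.log (φ y) - 2 * Real.log (φ ((1 / 2 : ℝ) • (x + y))) ≤
      2 * Real.log (G + 1) - 2 * Real.log c := by
  have hz : (1 / 2 : ℝ) • (x + y) ∈ Ω := by
    rw [smul_add]; exact hc hx hy (by norm_num) (by norm_num) (by norm_num)
  have hG := h.nonneg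
  have hup : ∀ x ∈ Ω, Real.log (φ x) ≤ Real.log (G + 1) + Real.log (infDist x (frontier Ω)) := by
    intro x hx
    have hd := ho.infDist_frontier_pos hne hx
    rw [← Real.log_mul (by positivity) hd.ne']
    refine Real.log_le_log (hpos x hx) ?_
    have := (le_abs_self _).trans (h.abs_le_mul_infDist hc hne hx)
    linarith
  have hlow : Real.log c + Real.log (infDist ((1 / 2 : ℝ) • (x + y)) (frontier Ω)) ≤
      Real.log (φ ((1 / 2 : ℝ) • (x + y))) := by
    have hd := ho.infDist_frontier_pos hne hz
    rw [← Real.log_mul hc0.ne' hd.ne']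
    exact Real.log_le_log (by positivity) (hopf _ hz)
  linarith [hup x hx, hup y hy, hc.log_infDist_frontier_add_le ho hne hx hy]

theorem abs_inner_gradient_log_le (h : IsDirichletRegular Ω φ G) (hc : Convex ℝ Ω)
    (ho : IsOpen Ω) (hne : (frontier Ω).Nonempty) (hpos : ∀ x ∈ Ω, 0 < φ x) (hc0 : 0 < c)
    (hopf : ∀ x ∈ Ω, c * infDist x (frontier Ω) ≤ φ x) {D : ℝ}
    (hD : ∀ x ∈ Ω, ∀ y ∈ Ω, ‖y - x‖ ≤ D) {x y : Euc n} (hx : x ∈ Ω) (hy : y ∈ Ω) :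
    |⟪gradient (fun w => Real.log (φ w)) ((1 / 2 : ℝ) • (x + y)), y - x⟫| ≤
      G * (D + 2) / c := by
  have hz : (1 / 2 : ℝ) • (x + y) ∈ Ω := by
    rw [smul_add]; exact hc hx hy (by norm_num) (by norm_num) (by norm_num)
  set z := (1 / 2 : ℝ) • (x + y) with hzdef
  obtain ⟨p, hp, ν, hν, hzp, hin, hray⟩ := hc.exists_nearest_frontier ho hne hz
  have hd := ho.infDist_frontier_pos hne hz
  have hT := h.norm_tangential_le hc ho hpos hz hp hν hzp hray
  have hN := abs_inner_le_of_midpoint hzdef hν hzp (hin x hx) (hin y hy)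
  have hφz := hpos z hz
  have hG := h.nonneg
  have hX := h.norm_gradient_le hz
  have hXν : |⟪gradient φ z, ν⟫| ≤ G := by
    have := abs_real_inner_le_norm (gradient φ z) ν
    rw [hν, mul_one] at this
    exact this.trans hX
  rw [gradient_log (h.differentiableAt hz) hφz.ne', inner_smul_left, abs_mul]
  simp only [conj_trivial]
  rw [abs_of_pos (inv_pos.2 hφz), inv_mul_le_iff₀ hφz]
  have e : ⟪gradient φ z, y - x⟫ = ⟪gradient φ z - ⟪gradient φ z, ν⟫ • ν, y - x⟫ +
      ⟪gradient φ z, ν⟫ * ⟪y - x, ν⟫ := by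
    rw [inner_sub_left, inner_smul_left, real_inner_comm ν (y - x)]
    simp
  have h1 : |⟪gradient φ z - ⟪gradient φ z, ν⟫ • ν, y - x⟫| ≤ G * infDist z (frontier Ω) * D :=
    (abs_real_inner_le_norm _ _).trans
      (mul_le_mul hT (hD x hx y hy) (norm_nonneg _) (by positivity))
  have h2 : |⟪gradient φ z, ν⟫ * ⟪y - x, ν⟫| ≤ G * (2 * infDist z (frontier Ω)) := by
    rw [abs_mul]; exact mul_le_mul hXν hN (abs_nonneg _) hG
  have hD0 : 0 ≤ D := (norm_nonneg _).trans (hD x hx y hy)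
  calc |⟪gradient φ z, y - x⟫| ≤ G * infDist z (frontier Ω) * D +
        G * (2 * infDist z (frontier Ω)) := by
        rw [e]; exact (abs_add_le _ _).trans (add_le_add h1 h2)
    _ = c * infDist z (frontier Ω) * (G * (D + 2) / c) := by field_simp
    _ ≤ φ z * (G * (D + 2) / c) :=
        mul_le_mul_of_nonneg_right (hopf z hz) (by positivity)

theorem uniform_div_infDist (h : IsDirichletRegular Ω φ G) (hc : Convex ℝ Ω)
    (ho : IsOpen Ω) (hb : Bornology.IsBounded Ω) (hne : (frontier Ω).Nonempty)
    (hpos : ∀ x ∈ Ω, 0 < φ x) {m : ℝ} (hm : 0 < m) :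
    ∃ ρ > 0, ∀ x ∈ Ω, ∀ y ∈ Ω, ‖y - x‖ < ρ →
      |φ y / infDist y (frontier Ω) - φ x / infDist x (frontier Ω)| < m := by
  have hG := h.nonneg
  obtain ⟨η, hη, hηm, -⟩ := exists_pos_mul_lt_and hm hm (4 * G) 0
  have hδc : Continuous fun x : Euc n => infDist x (frontier Ω) := continuous_infDist_pt _
  have hK : IsCompact (closure Ω ∩ {x : Euc n | η / 2 ≤ infDist x (frontier Ω)}) :=
    hb.isCompact_closure.inter_right (isClosed_le continuous_const hδc)
  have hq : ContinuousOn (fun x => φ x / infDist x (frontier Ω))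
      (closure Ω ∩ {x : Euc n | η / 2 ≤ infDist x (frontier Ω)}) :=
    (h.continuousOn.mono inter_subset_left).div hδc.continuousOn fun x hx =>
      ((half_pos hη).trans_le hx.2).ne'
  obtain ⟨ρ, hρ, hu⟩ := Metric.uniformContinuousOn_iff.1
    (hK.uniformContinuousOn_of_continuous hq) m hm
  have hnear : ∀ x ∈ Ω, |φ x / infDist x (frontier Ω) - ‖gradient φ x‖| ≤
      G * infDist x (frontier Ω) := by
    intro x hx
    obtain ⟨p, hp, ν, hν, hxp, -, -⟩ := hc.exists_nearest_frontier ho hne hx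
    have hd := ho.infDist_frontier_pos hne hx
    obtain ⟨h1, h2⟩ := h.near_boundary hc ho hpos hx hp hν hxp
    have h3 : ⟪gradient φ x, ν⟫ ≤ ‖gradient φ x‖ := by
      simpa [hν] using real_inner_le_norm (gradient φ x) ν
    rw [div_sub' hd.ne', abs_div, abs_of_pos hd, div_le_iff₀ hd, abs_le]
    constructor <;> nlinarith
  refine ⟨min ρ (η / 2), lt_min hρ (half_pos hη), fun x hx y hy hxy => ?_⟩
  have hxy1 : dist y x < ρ := by rw [dist_eq_norm]; exact hxy.trans_le (min_le_left _ _)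
  have hxy2 : dist y x < η / 2 := by rw [dist_eq_norm]; exact hxy.trans_le (min_le_right _ _)
  have d1 := infDist_le_infDist_add_dist (s := frontier Ω) (x := x) (y := y)
  have d2 := infDist_le_infDist_add_dist (s := frontier Ω) (x := y) (y := x)
  rw [dist_comm] at d1
  rcases le_total (infDist x (frontier Ω)) η with hdx | hdx
  · have h1 := hnear x hx
    have h2 := hnear y hy
    have h3 : |‖gradient φ y‖ - ‖gradient φ x‖| ≤ G * (η / 2) :=
      (abs_norm_sub_norm_le _ _).trans ((h.norm_gradient_sub_le hx hy).trans
        (mul_le_mul_of_nonneg_left (by rw [← dist_eq_norm]; exact hxy2.le) hG))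
    have h4 : G * infDist x (frontier Ω) ≤ G * η := mul_le_mul_of_nonneg_left hdx hG
    have h5 : G * infDist y (frontier Ω) ≤ G * (3 / 2 * η) :=
      mul_le_mul_of_nonneg_left (by linarith) hG
    have h6 : 0 ≤ G * η := by positivity
    rw [abs_le] at h1 h2 h3
    rw [abs_lt]
    constructor <;> linarith [h1.1, h1.2, h2.1, h2.2, h3.1, h3.2]
  · have := hu y ⟨subset_closure hy, show η / 2 ≤ infDist y (frontier Ω) by linarith⟩
      x ⟨subset_closure hx, show η / 2 ≤ infDist x (frontier Ω) by linarith⟩ hxy1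
    rwa [Real.dist_eq] at this

theorem log_midpoint_lt (h : IsDirichletRegular Ω φ G) (hc : Convex ℝ Ω) (ho : IsOpen Ω)
    (hb : Bornology.IsBounded Ω) (hne : (frontier Ω).Nonempty) (hpos : ∀ x ∈ Ω, 0 < φ x)
    (hc0 : 0 < c) (hopf : ∀ x ∈ Ω, c * infDist x (frontier Ω) ≤ φ x) {m : ℝ} (hm : 0 < m) :
    ∃ ρ > 0, ∀ x ∈ Ω, ∀ y ∈ Ω, ‖y - x‖ < ρ →
      Real.log (φ x) + Real.log (φ y) - 2 * Real.log (φ ((1 / 2 : ℝ) • (x + y))) < m := by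
  obtain ⟨ρ, hρ, hq⟩ := h.uniform_div_infDist hc ho hb hne hpos (m := c * m / 2) (by positivity)
  refine ⟨ρ, hρ, fun x hx y hy hxy => ?_⟩
  have hz : (1 / 2 : ℝ) • (x + y) ∈ Ω := by
    rw [smul_add]; exact hc hx hy (by norm_num) (by norm_num) (by norm_num)
  have hlog : ∀ a ∈ Ω, ∀ b ∈ Ω, ‖a - b‖ < ρ →
      Real.log (φ a) - Real.log (infDist a (frontier Ω)) -
        (Real.log (φ b) - Real.log (infDist b (frontier Ω))) < m / 2 := by
    intro a ha b hb hab
    have hda := ho.infDist_frontier_pos hne ha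
    have hdb := ho.infDist_frontier_pos hne hb
    have hpa := hpos a ha
    have hpb := hpos b hb
    have h1 := (abs_lt.1 (hq b hb a ha hab)).2
    have h2 : c ≤ φ b / infDist b (frontier Ω) := (le_div_iff₀ hdb).2 (hopf b hb)
    rw [← Real.log_div hpa.ne' hda.ne', ← Real.log_div hpb.ne' hdb.ne']
    set A := φ a / infDist a (frontier Ω)
    set B := φ b / infDist b (frontier Ω)
    have hA : 0 < A := by positivity
    have hB : 0 < B := by positivity
    rw [← Real.log_div hA.ne' hB.ne']
    refine (Real.log_le_sub_one_of_pos (by positivity)).trans_lt ?_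
    rw [div_sub_one hB.ne', div_lt_iff₀ hB]
    nlinarith
  have e1 : ‖x - (1 / 2 : ℝ) • (x + y)‖ < ρ := by
    rw [show x - (1 / 2 : ℝ) • (x + y) = -((1 / 2 : ℝ) • (y - x)) by module, norm_neg, norm_smul,
      Real.norm_of_nonneg (by norm_num)]
    linarith [norm_nonneg (y - x)]
  have e2 : ‖y - (1 / 2 : ℝ) • (x + y)‖ < ρ := by
    rw [show y - (1 / 2 : ℝ) • (x + y) = (1 / 2 : ℝ) • (y - x) by module, norm_smul,
      Real.norm_of_nonneg (by norm_num)]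
    linarith [norm_nonneg (y - x)]
  linarith [hlog x hx _ hz e1, hlog y hy _ hz e2, hc.log_infDist_frontier_add_le ho hne hx hy]

end IsDirichletRegular

end GroundState

section Quotient

variable {n : ℕ}

theorem lap_div_add {Ω : Set (Euc n)} (ho : IsOpen Ω) {V φ₀ φ₁ : Euc n → ℝ} {lam₀ lam₁ : ℝ}
    (h₀ : ∀ x ∈ Ω, ContDiffAt ℝ 2 φ₀ x) (h₁ : ∀ x ∈ Ω, ContDiffAt ℝ 2 φ₁ x)
    (hpos : ∀ x ∈ Ω, 0 < φ₀ x)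
    (e₀ : ∀ x ∈ Ω, -lap φ₀ x + V x * φ₀ x = lam₀ * φ₀ x)
    (e₁ : ∀ x ∈ Ω, -lap φ₁ x + V x * φ₁ x = lam₁ * φ₁ x) {x : Euc n} (hx : x ∈ Ω) :
    lap (fun y => φ₁ y / φ₀ y) x +
      2 * fderiv ℝ (fun y => φ₁ y / φ₀ y) x (gradient (fun y => Real.log (φ₀ y)) x) =
      -((lam₁ - lam₀) * (φ₁ x / φ₀ x)) := by
  have hp := hpos x hx
  have hw : ContDiffAt ℝ 2 (fun y => φ₁ y / φ₀ y) x := (h₁ x hx).div (h₀ x hx) hp.ne'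
  have hcongr : φ₁ =ᶠ[𝓝 x] fun y => φ₁ y / φ₀ y * φ₀ y := by
    filter_upwards [ho.mem_nhds hx] with y hy
    rw [div_mul_cancel₀ _ (hpos y hy).ne']
  have h2 := lap_mul hw (h₀ x hx)
  rw [← lap_congr hcongr] at h2
  rw [← inner_gradient_left, gradient_log ((h₀ x hx).differentiableAt (by simp)) hp.ne',
    inner_smul_right]
  have h3 := e₀ x hx
  have h4 := e₁ x hx
  have h5 : φ₁ x = φ₁ x / φ₀ x * φ₀ x := (div_mul_cancel₀ _ hp.ne').symm
  set w := φ₁ x / φ₀ x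
  set W := lap (fun y => φ₁ y / φ₀ y) x
  set I := ⟪gradient (fun y => φ₁ y / φ₀ y) x, gradient φ₀ x⟫
  rw [h5] at h4
  have h6 : φ₀ x * (W + 2 * ((φ₀ x)⁻¹ * I)) = φ₀ x * -((lam₁ - lam₀) * w) := by
    field_simp
    linear_combination w * h3 - h4 - h2
  exact mul_left_cancel₀ hp.ne' h6

end Quotient

/-- **Fundamental gap conjecture.**  If `Ω ⊂ ℝⁿ` is a bounded strictly convex open domain
with smooth boundary and diameter `D`, `V` is a smooth convex potential on `Ω̄`, `φ₀` is the
ground state of `L = -Δ + V` with Dirichlet boundary condition (with ground state energy `λ₀`)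
and `(λ₁, φ₁)` is any other Dirichlet eigenpair of `L`, then `λ₁ - λ₀ ≥ 3π²/D²`. -/
theorem fundamental_gap
    {n : ℕ} {Ω : Set (EuclideanSpace ℝ (Fin n))}
    (hΩopen : IsOpen Ω) (hΩne : Ω.Nonempty) (hΩbdd : Bornology.IsBounded Ω)
    (hΩconv : StrictConvex ℝ Ω)
    (hΩsmooth : ∃ r₀ > 0, ContDiffOn ℝ (⊤ : ℕ∞) (fun x => Metric.infDist x (frontier Ω))
      {x ∈ closure Ω | Metric.infDist x (frontier Ω) ≤ r₀})
    {V φ₀ φ₁ : EuclideanSpace ℝ (Fin n) → ℝ} {lam₀ lam₁ : ℝ}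
    (hV : ContDiffOn ℝ (⊤ : ℕ∞) V (closure Ω)) (hVconv : ConvexOn ℝ (closure Ω) V)
    (hφ₀smooth : ContDiffOn ℝ (⊤ : ℕ∞) φ₀ (closure Ω))
    (hφ₀pos : ∀ x ∈ Ω, 0 < φ₀ x)
    (hφ₀bd : ∀ x ∈ frontier Ω, φ₀ x = 0)
    (hφ₀eig : ∀ x ∈ Ω, -lap φ₀ x + V x * φ₀ x = lam₀ * φ₀ x)
    (hφ₁smooth : ContDiffOn ℝ (⊤ : ℕ∞) φ₁ (closure Ω))
    (hφ₁bd : ∀ x ∈ frontier Ω, φ₁ x = 0)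
    (hφ₁eig : ∀ x ∈ Ω, -lap φ₁ x + V x * φ₁ x = lam₁ * φ₁ x)
    (hratio_nonconst : ¬ ∃ c : ℝ, ∀ x ∈ Ω, φ₁ x = c * φ₀ x) :
    lam₁ - lam₀ ≥ 3 * Real.pi ^ 2 / (Metric.diam Ω) ^ 2 := by
  have hconv : Convex ℝ Ω := hΩconv.convex
  -- two points with different values of the quotient
  obtain ⟨x₁, hx₁, y₁, hy₁, hlt⟩ :
      ∃ x ∈ Ω, ∃ y ∈ Ω, φ₁ x / φ₀ x < φ₁ y / φ₀ y := by
    by_contra! hle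
    obtain ⟨x, hx⟩ := hΩne
    refine hratio_nonconst ⟨φ₁ x / φ₀ x, fun y hy => ?_⟩
    rw [le_antisymm (hle y hy x hx) (hle x hx y hy), div_mul_cancel₀ _ (hφ₀pos y hy).ne']
  have hne₁ : x₁ ≠ y₁ := by rintro rfl; exact lt_irrefl _ hlt
  have : Nontrivial (Euc n) := ⟨x₁, y₁, hne₁⟩
  have hfr : (frontier Ω).Nonempty := nonempty_frontier_iff.2 ⟨hΩne, fun h =>
    NormedSpace.unbounded_univ ℝ (Euc n) (h ▸ hΩbdd)⟩
  have hD : ∀ x ∈ Ω, ∀ y ∈ Ω, ‖y - x‖ ≤ diam Ω := fun x hx y hy => by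
    rw [← dist_eq_norm]; exact dist_le_diam_of_mem hΩbdd hy hx
  have hDpos : 0 < diam Ω := (norm_pos_iff.2 (sub_ne_zero.2 hne₁.symm)).trans_le
    (hD x₁ hx₁ y₁ hy₁)
  have hKc := hΩbdd.isCompact_closure
  -- regularity up to the boundary
  obtain ⟨G₀, hG₀⟩ := exists_isDirichletRegular hΩopen hΩne hΩbdd hconv hφ₀smooth hφ₀bd
  obtain ⟨G₁, hG₁⟩ := exists_isDirichletRegular hΩopen hΩne hΩbdd hconv hφ₁smooth hφ₁bd
  have h₀ : ∀ x ∈ Ω, ContDiffAt ℝ 2 φ₀ x := fun x hx =>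
    (hG₀.contDiffAt x hx).of_le (by norm_num)
  have h₁ : ∀ x ∈ Ω, ContDiffAt ℝ 2 φ₁ x := fun x hx =>
    (hG₁.contDiffAt x hx).of_le (by norm_num)
  obtain ⟨M, hM⟩ := hKc.exists_bound_of_continuousOn
    (hV.continuousOn.sub (continuousOn_const (c := lam₀)))
  have hM' : ∀ x ∈ Ω, |V x - lam₀| ≤ M := fun x hx => hM x (subset_closure hx)
  have hM0 : 0 ≤ M := (abs_nonneg _).trans (hM' x₁ hx₁)
  have hlap : ∀ x ∈ Ω, lap φ₀ x = (V x - lam₀) * φ₀ x := fun x hx => by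
    linarith [hφ₀eig x hx]
  obtain ⟨r₀, hr₀, hdist⟩ := hΩsmooth
  obtain ⟨c, hc, hopf⟩ := exists_pos_mul_infDist_le hΩopen hconv hfr hΩne hΩbdd hr₀
    (hdist.of_le (WithTop.coe_le_coe.2 (le_top : (2 : ℕ∞) ≤ ⊤))) hφ₀smooth.continuousOn h₀
    hφ₀pos hφ₀bd hM0 fun x hx => by
      rw [hlap x hx]
      exact mul_le_mul_of_nonneg_right ((le_abs_self _).trans (hM' x hx)) (hφ₀pos x hx).le
  obtain ⟨S, hS⟩ := hKc.exists_bound_of_continuousOn hφ₀smooth.continuousOn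
  -- the logarithm of the ground state
  have hlog : IsLogGroundState Ω (fun x => Real.log (φ₀ x)) (fun x => V x - lam₀) M
      (Real.log S) := by
    refine ⟨hΩopen, hΩbdd, fun x hx => (hG₀.contDiffAt x hx).log (hφ₀pos x hx).ne',
      fun x hx => ?_, ?_, fun x hx => ?_, fun x hx => (abs_le.1 (hM' x hx)).1,
      fun x hx => ?_, fun q hq => ?_⟩
    · rw [lap_log (h₀ x hx) (hφ₀pos x hx).ne', hlap x hx,
        mul_div_cancel_right₀ _ (hφ₀pos x hx).ne']
    · exact (hVconv.subset subset_closure hconv).sub (concaveOn_const lam₀ hconv)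
    · exact ((hV.contDiffAt (mem_of_superset (hΩopen.mem_nhds hx)
        subset_closure)).differentiableAt (by simp)).sub_const _
    · exact Real.log_le_log (hφ₀pos x hx) ((le_abs_self _).trans (hS x (subset_closure hx)))
    · refine Real.tendsto_log_nhdsNE_zero.comp (tendsto_nhdsWithin_iff.2 ⟨?_, ?_⟩)
      · have := (hφ₀smooth.continuousOn q (frontier_subset_closure hq)).mono_left
          (nhdsWithin_mono q subset_closure)
        rwa [hφ₀bd q hq] at this
      · filter_upwards [self_mem_nhdsWithin] with x hx using (hφ₀pos x hx).ne'
  have hmid : ∀ x ∈ Ω, ∀ y ∈ Ω, Real.log (φ₀ x) + Real.log (φ₀ y) ≤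
      2 * Real.log (φ₀ ((1 / 2 : ℝ) • (x + y))) := fun x hx y hy =>
    hlog.midpoint_concave
      (fun x hx y hy => hG₀.log_midpoint_le hconv hΩopen hfr hφ₀pos hc hopf hx hy)
      (fun x hx y hy => hG₀.abs_inner_gradient_log_le hconv hΩopen hfr hφ₀pos hc hopf hD hx hy)
      (fun m hm => hG₀.log_midpoint_lt hconv hΩopen hΩbdd hfr hφ₀pos hc hopf hm) hx hy
  have hmono := fun x hx y hy => hlog.gradient_antitone hmid (x := x) (y := y) hx hy
  -- the quotient is bounded
  have hB : ∀ x ∈ Ω, |φ₁ x / φ₀ x| ≤ G₁ / c := fun x hx => by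
    have hp := hφ₀pos x hx
    have hd := hΩopen.infDist_frontier_pos hfr hx
    rw [abs_div, abs_of_pos hp, div_le_div_iff₀ hp hc]
    calc |φ₁ x| * c ≤ G₁ * infDist x (frontier Ω) * c :=
          mul_le_mul_of_nonneg_right (hG₁.abs_le_mul_infDist hconv hfr hx) hc.le
      _ = G₁ * (c * infDist x (frontier Ω)) := by ring
      _ ≤ G₁ * φ₀ x := mul_le_mul_of_nonneg_left (hopf x hx) hG₁.nonneg
  have key : ∀ a : ℝ, 0 < a → a < Real.pi / diam Ω → 3 * a ^ 2 ≤ lam₁ - lam₀ := by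
    intro a ha haD
    rw [lt_div_iff₀ hDpos] at haD
    exact hlog.three_mul_sq_le ha haD hD
      (fun x hx y hy hxy => hlog.modulus_of_concavity hmono ha haD hD hx hy hxy)
      (fun x hx => (h₁ x hx).div (h₀ x hx) (hφ₀pos x hx).ne')
      (fun x hx => lap_div_add hΩopen h₀ h₁ hφ₀pos hφ₀eig hφ₁eig hx) hB hx₁ hy₁ hlt
  have hlim : Tendsto (fun a : ℝ => 3 * a ^ 2) (𝓝[<] (Real.pi / diam Ω))
      (𝓝 (3 * (Real.pi / diam Ω) ^ 2)) :=
    ((by fun_prop : Continuous fun a : ℝ => 3 * a ^ 2).tendsto _).mono_left nhdsWithin_le_nhds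
  have hfin := le_of_tendsto hlim (b := lam₁ - lam₀) (by
    filter_upwards [Ioo_mem_nhdsLT (div_pos Real.pi_pos hDpos)] with a ha
    exact key a ha.1 ha.2)
  rwa [div_pow, ← mul_div_assoc] at hfin
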